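/- arXiv:1605.07570 — 2 statements merged into one kernel-verified Lean document; each statement's English description precedes it below -/
import Mathlib

section
/- Let 0 < p < 1 be a constant. There exist a constant K = K(p) and N such that for all n ≥ N and every m with (p/2)·n² ≤ m ≤ ((1+p)/2)·n², one has P( X_{n,m} ≥ K · E[X_{n,m}] ) ≤ n^{−4}. -/
open scoped Classical

/-- The number of perfect matchings of the bipartite graph with edge set `S ⊆ [n]×[n]`,
i.e. the number of permutations `σ` of `[n]` with `(i, σ i) ∈ S` for all `i`. -/
def matchCount (n : ℕ) (S : Finset (Fin n × Fin n)) : ℕ :=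
  (Finset.univ.filter (fun σ : Equiv.Perm (Fin n) => ∀ i : Fin n, (i, σ i) ∈ S)).card

/-- `E[X_{n,m}]`, the expected number of perfect matchings of a uniformly random
`m`-element subset of `[n]×[n]`. -/
noncomputable def meanX (n m : ℕ) : ℝ :=
  (∑ S ∈ Finset.powersetCard m (Finset.univ : Finset (Fin n × Fin n)),
      ((matchCount n S : ℝ))) / (Nat.choose (n ^ 2) m)

/-- `P(X_{n,m} ≥ c)` for the uniform random `m`-subset model. -/
noncomputable def probX_ge (n m : ℕ) (c : ℝ) : ℝ :=
  (((Finset.powersetCard m (Finset.univ : Finset (Fin n × Fin n))).filter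
      (fun S => c ≤ (matchCount n S : ℝ))).card : ℝ) / (Nat.choose (n ^ 2) m)

open Finset in
theorem card_superset {α : Type*} [Fintype α] [DecidableEq α] (m : ℕ) (U : Finset α) (h : U.card ≤ m) :
    ((powersetCard m (univ : Finset α)).filter (fun S => U ⊆ S)).card
      = (Fintype.card α - U.card).choose (m - U.card) := by
  rw [← Finset.card_compl, ← Finset.card_powersetCard]
  refine Finset.card_bij' (fun S _ => S \ U) (fun S _ => S ∪ U) ?_ ?_ ?_ ?_
  · intro S hS
    simp only [mem_filter, mem_powersetCard, subset_univ, true_and] at hS ⊢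
    refine ⟨?_, ?_⟩
    · intro x hx
      simp only [mem_sdiff] at hx
      simpa using hx.2
    · rw [card_sdiff_of_subset hS.2, hS.1]
  · intro S hS
    simp only [mem_filter, mem_powersetCard, subset_univ, true_and] at hS ⊢
    refine ⟨?_, subset_union_right⟩
    rw [card_union_of_disjoint, hS.2]
    · omega
    · rw [Finset.disjoint_left]
      intro x hx
      simpa using hS.1 hx
  · intro S hS
    simp only [mem_filter] at hS
    exact sdiff_union_of_subset hS.2
  · intro S hS
    simp only [mem_powersetCard] at hS
    ext x
    have := @hS.1 x
    simp only [mem_sdiff, mem_union, mem_compl] at this ⊢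
    tauto

/-- falling factorial ratio -/
noncomputable def fr (N m u : ℕ) : ℝ := ∏ t ∈ Finset.range u, (((m : ℝ) - t) / ((N : ℝ) - t))

theorem choose_fr (N m : ℕ) (hm : m ≤ N) (u : ℕ) (hu : u ≤ m) :
    ((N - u).choose (m - u) : ℝ) = N.choose m * fr N m u := by
  induction u with
  | zero => simp [fr]
  | succ u ih =>
    have ih := ih (by omega)
    rw [fr, Finset.prod_range_succ, ← fr, ← mul_assoc, ← ih]
    obtain ⟨a, rfl⟩ : ∃ a, m = u + 1 + a := ⟨m - (u+1), by omega⟩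
    obtain ⟨b, rfl⟩ : ∃ b, N = u + 1 + a + b := ⟨N - (u+1+a), by omega⟩
    have e1 : u + 1 + a + b - (u+1) = a + b := by omega
    have e2 : u + 1 + a - (u+1) = a := by omega
    have e3 : u + 1 + a + b - u = a + b + 1 := by omega
    have e4 : u + 1 + a - u = a + 1 := by omega
    rw [e1, e2, e3, e4]
    have h := Nat.add_one_mul_choose_eq (a+b) a
    have h' : ((a:ℝ)+b+1) * (a+b).choose a = (a+b+1).choose (a+1) * (a+1) := by exact_mod_cast h
    have hpos : (0:ℝ) < (a:ℝ)+b+1 := by positivity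
    have e5 : (((u + 1 + a : ℕ) : ℝ) - u) = a + 1 := by push_cast; ring
    have e6 : (((u + 1 + a + b: ℕ) : ℝ) - u) = a + b + 1 := by push_cast; ring
    rw [e5, e6, ← mul_div_assoc, ← h']
    field_simp

theorem fr_pos (N m u : ℕ) (hm : m ≤ N) (hu : u ≤ m) : 0 < fr N m u := by
  apply Finset.prod_pos
  intro t ht
  have ht := Finset.mem_range.1 ht
  have h1 : (t:ℝ) < m := by exact_mod_cast (by omega : t < m)
  have h2 : (m:ℝ) ≤ N := by exact_mod_cast hm
  apply div_pos <;> linarith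

theorem fr_le (N m L : ℕ) (hm : m ≤ N) (hL : L < m) (j : ℕ) (hj : j ≤ L) :
    fr N m (L - j) ≤ fr N m L * (((N:ℝ) - L) / ((m:ℝ) - L)) ^ j := by
  have h2 : (m:ℝ) ≤ N := by exact_mod_cast hm
  have h3 : (L:ℝ) < m := by exact_mod_cast hL
  induction j with
  | zero => simp
  | succ j ih =>
    have ih := ih (by omega)
    obtain ⟨u, hu⟩ : ∃ u, u = L - (j+1) := ⟨_, rfl⟩
    have e : L - j = u + 1 := by omega
    have h4 : (u:ℝ) < L := by exact_mod_cast (by omega : u < L)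
    rw [← hu]
    rw [e, fr, Finset.prod_range_succ, ← fr] at ih
    have hp := fr_pos N m u hm (by omega)
    have hg : 0 < ((m : ℝ) - u) / ((N : ℝ) - u) := by apply div_pos <;> linarith
    have ha : 0 < ((N:ℝ) - L) / ((m:ℝ) - L) := by apply div_pos <;> linarith
    have key : 1 ≤ ((m : ℝ) - u) / ((N : ℝ) - u) * (((N:ℝ) - L) / ((m:ℝ) - L)) := by
      rw [div_mul_div_comm, le_div_iff₀ (by apply mul_pos <;> linarith)]
      nlinarith
    calc fr N m u ≤ fr N m u * (((m : ℝ) - u) / ((N : ℝ) - u) * (((N:ℝ) - L) / ((m:ℝ) - L))) :=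
          le_mul_of_one_le_right hp.le key
      _ = fr N m u * (((m : ℝ) - u) / ((N : ℝ) - u)) * (((N:ℝ) - L) / ((m:ℝ) - L)) := by ring
      _ ≤ _ := by rw [pow_succ, ← mul_assoc]; gcongr

theorem fr_mul_le (N m n L : ℕ) (hm : m ≤ N) (hL : L < m) (k : ℕ) (hk : k * n ≤ L) :
    fr N m (k * n) ≤ fr N m n ^ k *
      Real.exp (-(n * n * (1 / (m:ℝ) - 1 / ((N:ℝ) - L))) * ∑ j ∈ Finset.range k, (j:ℝ)) := by
  have h2 : (m:ℝ) ≤ N := by exact_mod_cast hm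
  have h3 : (L:ℝ) < m := by exact_mod_cast hL
  induction k with
  | zero => simp [fr]
  | succ k ih =>
    have hk' : k * n + n ≤ L := by linarith [Nat.succ_mul k n]
    have ih := ih (by omega)
    have e : fr N m ((k+1)*n) = fr N m (k*n) *
        ∏ t ∈ Finset.range n, (((m : ℝ) - (k*n+t:ℕ)) / ((N : ℝ) - (k*n+t:ℕ))) := by
      rw [Nat.succ_mul, fr, Finset.prod_range_add, ← fr]
    have key : ∏ t ∈ Finset.range n, (((m : ℝ) - (k*n+t:ℕ)) / ((N : ℝ) - (k*n+t:ℕ)))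
        ≤ fr N m n * Real.exp (-(n * n * (1 / (m:ℝ) - 1 / ((N:ℝ) - L))) * k) := by
      calc _ ≤ ∏ t ∈ Finset.range n, ((((m : ℝ) - t) / ((N : ℝ) - t)) *
            Real.exp (-(k * n * (1 / (m:ℝ) - 1 / ((N:ℝ) - L))))) := by
            apply Finset.prod_le_prod
            · intro t ht
              have ht := Finset.mem_range.1 ht
              have : ((k*n+t:ℕ):ℝ) < L := by exact_mod_cast (by omega : k*n+t < L)
              apply div_nonneg <;> linarith
            · intro t ht
              have ht := Finset.mem_range.1 ht
              have h5 : ((k*n+t:ℕ):ℝ) < L := by exact_mod_cast (by omega : k*n+t < L)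
              push_cast at h5 ⊢
              obtain ⟨s, hs⟩ : ∃ s : ℝ, s = (k:ℝ) * n := ⟨_, rfl⟩
              have hs0 : 0 ≤ s := by rw [hs]; positivity
              rw [← hs] at h5 ⊢
              have ht0 : (0:ℝ) ≤ t := by positivity
              have a1 : ((m:ℝ) - (s + t)) ≤ (m - t) * Real.exp (-(s / m)) := by
                have := Real.add_one_le_exp (-(s/m))
                have h6 : ((m:ℝ) - (s + t)) ≤ (m - t) * (-(s/m) + 1) := by
                  have : (m - (t:ℝ)) * (-(s/m) + 1) = m - (s+t) + t * s / m := by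
                    field_simp [show (m:ℝ) ≠ 0 by linarith]; ring
                  rw [this]
                  have : 0 ≤ t * s / m := by positivity
                  linarith
                refine h6.trans ?_
                apply mul_le_mul_of_nonneg_left this; linarith
              have a2 : ((N:ℝ) - t) ≤ (N - (s + t)) * Real.exp (s / (N - L)) := by
                have := Real.add_one_le_exp (s/(N-L))
                have h6 : ((N:ℝ) - t) ≤ (N - (s + t)) * (s/(N-L) + 1) := by
                  have hd : s ≤ (N - (s+t)) * (s/(N-L)) := by
                    rw [← mul_div_assoc, le_div_iff₀ (by linarith)]
                    nlinarith
                  linarith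
                refine h6.trans ?_
                apply mul_le_mul_of_nonneg_left this; linarith
              have e7 : -(s * (1 / (m:ℝ) - 1 / ((N:ℝ) - L))) = -(s/m) + s/(N-L) := by ring
              rw [e7, Real.exp_add, div_mul_eq_mul_div, div_le_div_iff₀ (by linarith) (by linarith)]
              calc ((m:ℝ) - (s + t)) * (N - t)
                  ≤ ((m - t) * Real.exp (-(s / m))) * ((N - (s + t)) * Real.exp (s / (N - L))) := by
                    apply mul_le_mul a1 a2 (by linarith)
                    apply mul_nonneg (by linarith) (Real.exp_pos _).le
                _ = _ := by ring
        _ = _ := by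
            rw [Finset.prod_mul_distrib, ← fr, Finset.prod_const, Finset.card_range, ← Real.exp_nat_mul]
            congr 2; ring
    rw [e, Finset.sum_range_succ, mul_add, Real.exp_add, pow_succ]
    calc _ ≤ (fr N m n ^ k *
      Real.exp (-(n * n * (1 / (m:ℝ) - 1 / ((N:ℝ) - L))) * ∑ j ∈ Finset.range k, (j:ℝ))) *
       (fr N m n * Real.exp (-(n * n * (1 / (m:ℝ) - 1 / ((N:ℝ) - L))) * k)) := by
          apply mul_le_mul ih key
          · apply Finset.prod_nonneg
            intro t ht
            have ht := Finset.mem_range.1 ht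
            have : ((k*n+t:ℕ):ℝ) < L := by exact_mod_cast (by omega : k*n+t < L)
            apply div_nonneg <;> linarith
          · exact (mul_pos (pow_pos (fr_pos N m n hm (by omega)) _) (Real.exp_pos _)).le
      _ = _ := by ring

open Finset in
theorem card_fix (n : ℕ) (T : Finset (Fin n)) :
    (univ.filter (fun σ : Equiv.Perm (Fin n) => ∀ i ∈ T, σ i = i)).card = (n - T.card).factorial := by
  have h := Fintype.card_congr (Equiv.Perm.subtypeEquivSubtypePerm (fun i : Fin n => i ∉ T))
  rw [Fintype.card_perm] at h
  have h2 : Fintype.card {i : Fin n // i ∉ T} = n - T.card := by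
    rw [Fintype.card_subtype_compl]; simp
  rw [h2] at h
  rw [h, Fintype.card_subtype]
  congr 1
  ext σ; simp

open Finset in
theorem card_restr (n d : ℕ) (U : Finset (Fin n × Fin n))
    (hU : ∀ i, (univ.filter (fun j => (i, j) ∈ U)).card ≤ d) (T : Finset (Fin n)) :
    (univ.filter (fun σ : Equiv.Perm (Fin n) => ∀ i ∈ T, (i, σ i) ∈ U)).card
      ≤ d ^ T.card * (n - T.card).factorial := by
  set A := univ.filter (fun σ : Equiv.Perm (Fin n) => ∀ i ∈ T, (i, σ i) ∈ U) with hA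
  let B : Finset (T → Fin n) := Fintype.piFinset (fun i : T => univ.filter (fun j => (i.1, j) ∈ U))
  have hB : B.card ≤ d ^ T.card := by
    rw [Fintype.card_piFinset]
    calc _ ≤ ∏ i : T, d := Finset.prod_le_prod' (fun i _ => hU i)
      _ = _ := by simp
  let f : Equiv.Perm (Fin n) → (T → Fin n) := fun σ i => σ i
  have h := Finset.card_le_mul_card_image_of_maps_to (f := f) (s := A) (t := B) ?_ (n - T.card).factorial ?_
  · rw [mul_comm] at h
    exact h.trans (Nat.mul_le_mul_right _ hB)
  · intro σ hσ
    simp only [hA, mem_filter, mem_univ, true_and] at hσ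
    simp only [B, f, Fintype.mem_piFinset, mem_filter, mem_univ, true_and]
    intro i; exact hσ i i.2
  · intro b hb
    by_cases hne : (A.filter (fun σ => f σ = b)).Nonempty
    · obtain ⟨σ0, h0⟩ := hne
      have h0 := (mem_filter.1 h0).2
      rw [← card_fix n T]
      apply Finset.card_le_card_of_injOn (fun σ => σ0⁻¹ * σ)
      · intro σ hσ
        have hσ := (mem_filter.1 (mem_coe.1 hσ)).2
        simp only [coe_filter, mem_univ, true_and, Set.mem_ofPred_eq]
        intro i hi
        have : σ i = σ0 i := congrFun (hσ.trans h0.symm) ⟨i, hi⟩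
        simp [this]
      · intro σ _ τ _ hh
        simpa using hh
    · rw [not_nonempty_iff_eq_empty.1 hne]; simp

/-- graph of a permutation -/
def gr {n : ℕ} (σ : Equiv.Perm (Fin n)) : Finset (Fin n × Fin n) :=
  Finset.univ.image (fun i => (i, σ i))

open Finset in
theorem sum_perm (n d : ℕ) (U : Finset (Fin n × Fin n))
    (hU : ∀ i, (univ.filter (fun j => (i, j) ∈ U)).card ≤ d) (b : ℝ) (hb : 0 ≤ b) :
    ∑ σ : Equiv.Perm (Fin n), (1 + b) ^ (gr σ ∩ U).card ≤ n.factorial * Real.exp (b * d) := by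
  have h1 : ∀ σ : Equiv.Perm (Fin n), (1 + b) ^ (gr σ ∩ U).card
      = ∑ T : Finset (Fin n), if ∀ i ∈ T, (i, σ i) ∈ U then b ^ T.card else 0 := by
    intro σ
    have e : (gr σ ∩ U).card = (univ.filter (fun i => (i, σ i) ∈ U)).card := by
      symm
      apply Finset.card_bij (fun i _ => (i, σ i))
      · intro i hi; simpa [gr] using hi
      · intro i _ j _ h; exact (Prod.mk.inj h).1
      · intro x hx
        simp only [gr, mem_inter, mem_image, mem_univ, true_and] at hx
        obtain ⟨⟨i, rfl⟩, h⟩ := hx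
        exact ⟨i, by simpa using h, rfl⟩
    rw [e, ← Finset.prod_const, add_comm (1:ℝ) b, Finset.prod_add]
    rw [← Finset.sum_filter]
    apply Finset.sum_congr
    · ext T; simp [Finset.subset_iff]
    · intro T _; simp
  calc _ = ∑ T : Finset (Fin n), ∑ σ : Equiv.Perm (Fin n),
        if ∀ i ∈ T, (i, σ i) ∈ U then b ^ T.card else 0 := by
        rw [Finset.sum_comm]; exact Finset.sum_congr rfl (fun σ _ => h1 σ)
    _ ≤ ∑ T : Finset (Fin n), (d:ℝ) ^ T.card * (n - T.card).factorial * b ^ T.card := by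
        apply Finset.sum_le_sum
        intro T _
        rw [← Finset.sum_filter, Finset.sum_const, nsmul_eq_mul]
        have := card_restr n d U hU T
        have : ((univ.filter (fun σ : Equiv.Perm (Fin n) => ∀ i ∈ T, (i, σ i) ∈ U)).card : ℝ)
          ≤ (d:ℝ) ^ T.card * (n - T.card).factorial := by exact_mod_cast this
        gcongr
    _ = ∑ j ∈ range (n+1), (n.choose j : ℝ) * ((d:ℝ) ^ j * (n - j).factorial * b ^ j) := by
        rw [← Finset.powerset_univ, Finset.sum_powerset]
        simp only [card_univ, Fintype.card_fin]
        apply Finset.sum_congr rfl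
        intro j _
        rw [Finset.sum_congr rfl (g := fun _ => (d:ℝ) ^ j * (n - j).factorial * b ^ j)]
        · simp
        · intro T hT
          rw [(mem_powersetCard.1 hT).2]
    _ = n.factorial * ∑ j ∈ range (n+1), (b * d) ^ j / j.factorial := by
        rw [Finset.mul_sum]
        apply Finset.sum_congr rfl
        intro j hj
        have hj : j ≤ n := by simpa [Nat.lt_succ_iff] using hj
        have := Nat.choose_mul_factorial_mul_factorial hj
        rw [← this]
        have : (j.factorial : ℝ) ≠ 0 := by positivity
        push_cast
        field_simp
        ring
    _ ≤ _ := by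
        gcongr
        exact Real.sum_le_exp_of_nonneg (by positivity) _

open Finset in
theorem card_gr {n : ℕ} (σ : Equiv.Perm (Fin n)) : (gr σ).card = n := by
  rw [gr, card_image_of_injective _ (fun i j h => (Prod.mk.inj h).1)]; simp

theorem gr_subset {n : ℕ} (σ : Equiv.Perm (Fin n)) (S : Finset (Fin n × Fin n)) :
    gr σ ⊆ S ↔ ∀ i, (i, σ i) ∈ S := by
  simp [gr, Finset.image_subset_iff]

open Finset in
theorem matchCount_eq (n : ℕ) (S : Finset (Fin n × Fin n)) :
    (matchCount n S : ℝ) = ∑ σ : Equiv.Perm (Fin n), if gr σ ⊆ S then (1:ℝ) else 0 := by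
  rw [Finset.sum_boole, matchCount]
  simp only [gr_subset]

open Finset in
theorem row_union {n : ℕ} (U : Finset (Fin n × Fin n)) (d : ℕ)
    (hU : ∀ i, (univ.filter (fun j => (i, j) ∈ U)).card ≤ d) (σ : Equiv.Perm (Fin n)) (i : Fin n) :
    (univ.filter (fun j => (i, j) ∈ U ∪ gr σ)).card ≤ d + 1 := by
  have : (univ.filter (fun j => (i, j) ∈ U ∪ gr σ)) ⊆ insert (σ i) (univ.filter (fun j => (i, j) ∈ U)) := by
    intro j hj
    simp only [gr, mem_filter, mem_univ, true_and, mem_union, mem_image, mem_insert, Prod.mk.injEq] at hj ⊢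
    rcases hj with h | ⟨x, rfl, h⟩
    · exact Or.inr h
    · exact Or.inl h.symm
  exact (card_le_card this).trans ((card_insert_le _ _).trans (by have := hU i; omega))

open Finset in
theorem card_of_row {n : ℕ} (U : Finset (Fin n × Fin n)) (d : ℕ)
    (hU : ∀ i, (univ.filter (fun j => (i, j) ∈ U)).card ≤ d) : U.card ≤ d * n := by
  have h : U.card = ∑ i : Fin n, (univ.filter (fun j => (i, j) ∈ U)).card := by
    rw [Finset.card_eq_sum_card_fiberwise (f := Prod.fst) (t := univ) (by intro x _; simp)]
    apply Finset.sum_congr rfl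
    intro i _
    symm
    apply Finset.card_bij (fun j _ => (i, j))
    · intro j hj; simpa using hj
    · intro j _ j' _ h; exact (Prod.mk.inj h).2
    · rintro ⟨x, y⟩ hx
      simp only [mem_filter] at hx
      obtain ⟨h1, rfl⟩ := hx
      exact ⟨y, by simpa using h1, rfl⟩
  rw [h]
  calc _ ≤ ∑ i : Fin n, d := Finset.sum_le_sum (fun i _ => hU i)
    _ = _ := by simp [mul_comm]

/-- restricted moment -/
noncomputable def mom (n m k : ℕ) (U : Finset (Fin n × Fin n)) : ℝ :=
  ∑ S ∈ (Finset.powersetCard m (Finset.univ : Finset (Fin n × Fin n))).filter (fun S => U ⊆ S),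
    (matchCount n S : ℝ) ^ k

open Finset in
theorem mom_succ (n m k : ℕ) (U : Finset (Fin n × Fin n)) :
    mom n m (k+1) U = ∑ σ : Equiv.Perm (Fin n), mom n m k (U ∪ gr σ) := by
  simp only [mom]
  have h : ∀ S : Finset (Fin n × Fin n), (matchCount n S : ℝ) ^ (k+1) =
      ∑ σ : Equiv.Perm (Fin n), if gr σ ⊆ S then (matchCount n S : ℝ) ^ k else 0 := by
    intro S
    rw [pow_succ]
    nth_rewrite 2 [matchCount_eq]
    rw [Finset.mul_sum]
    simp
  simp_rw [h]
  rw [Finset.sum_comm]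
  apply Finset.sum_congr rfl
  intro σ _
  rw [← Finset.sum_filter, Finset.filter_filter]
  apply Finset.sum_congr _ (fun _ _ => rfl)
  ext S
  simp [union_subset_iff]

open Finset in
theorem mom_zero (n m : ℕ) (hm : m ≤ n ^ 2) (U : Finset (Fin n × Fin n)) (hU : U.card ≤ m) :
    mom n m 0 U = (n ^ 2).choose m * fr (n ^ 2) m U.card := by
  rw [← choose_fr _ _ hm _ hU]
  simp only [mom, pow_zero, sum_const, nsmul_eq_mul, mul_one]
  rw [card_superset m U hU]
  simp [sq]

open Finset in
theorem meanX_eq (n m : ℕ) (hm : m ≤ n ^ 2) (hn : n ≤ m) :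
    meanX n m = n.factorial * fr (n ^ 2) m n := by
  have h : (∑ S ∈ Finset.powersetCard m (Finset.univ : Finset (Fin n × Fin n)),
      ((matchCount n S : ℝ))) = mom n m 1 ∅ := by simp [mom]
  have hc : (0:ℝ) < (n^2).choose m := by exact_mod_cast Nat.choose_pos hm
  rw [meanX, h, mom_succ, div_eq_iff hc.ne']
  rw [Finset.sum_congr rfl (g := fun _ => ((n ^ 2).choose m : ℝ) * fr (n ^ 2) m n)]
  · simp [Fintype.card_perm]; ring
  · intro σ _
    rw [empty_union, mom_zero n m hm _ (by rw [card_gr]; exact hn), card_gr]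

open Finset in
theorem mom_le (n m L : ℕ) (hm : m ≤ n ^ 2) (hL : L < m) (b : ℝ) (hb0 : 0 ≤ b)
    (hb : 1 + b = (((n^2:ℕ):ℝ) - L) / ((m:ℝ) - L)) (k : ℕ) :
    ∀ (i : ℕ) (U : Finset (Fin n × Fin n)), (i + k) * n ≤ L →
    (∀ x, (univ.filter (fun j => (x, j) ∈ U)).card ≤ i) →
    mom n m k U * (1 + b) ^ (U.card + k * n) ≤
      (n.factorial : ℝ) ^ k * Real.exp (b * ∑ j ∈ range k, ((i:ℝ) + j)) *
        ((n ^ 2).choose m * fr (n ^ 2) m L * (1 + b) ^ L) := by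
  induction k with
  | zero =>
    intro i U hi hU
    have hc := card_of_row U i hU
    have hUL : U.card ≤ L := by simp at hi; omega
    rw [mom_zero n m hm U (by omega)]
    have h := fr_le (n^2) m L hm hL (L - U.card) (by omega)
    rw [← hb, Nat.sub_sub_self hUL] at h
    simp only [zero_mul, add_zero, pow_zero, range_zero, sum_empty, mul_zero, Real.exp_zero, one_mul]
    have hb1 : 0 ≤ 1 + b := by linarith
    calc _ ≤ ((n ^ 2).choose m : ℝ) * (fr (n ^ 2) m L * (1 + b) ^ (L - U.card)) * (1+b)^U.card := by
          gcongr
      _ = ((n ^ 2).choose m : ℝ) * fr (n ^ 2) m L * ((1 + b) ^ (L - U.card) * (1+b)^U.card) := by ring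
      _ = _ := by rw [← pow_add, Nat.sub_add_cancel hUL]
  | succ k ih =>
    intro i U hi hU
    have hb1 : 0 ≤ 1 + b := by linarith
    set M := (n.factorial : ℝ) ^ k * Real.exp (b * ∑ j ∈ range k, (((i + 1 : ℕ):ℝ) + j)) *
        ((n ^ 2).choose m * fr (n ^ 2) m L * (1 + b) ^ L) with hM
    have hfr := (fr_pos (n^2) m L hm hL.le).le
    have hM0 : 0 ≤ M := by positivity
    calc _ = ∑ σ : Equiv.Perm (Fin n), (mom n m k (U ∪ gr σ) * (1+b)^((U ∪ gr σ).card + k * n)) *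
          (1+b)^(gr σ ∩ U).card := by
          rw [mom_succ, Finset.sum_mul]
          apply Finset.sum_congr rfl
          intro σ _
          rw [mul_assoc, ← pow_add]
          congr 2
          have := Finset.card_union_add_card_inter U (gr σ)
          rw [card_gr, inter_comm] at this
          rw [Nat.succ_mul]; omega
      _ ≤ ∑ σ : Equiv.Perm (Fin n), M * (1+b)^(gr σ ∩ U).card := by
          apply Finset.sum_le_sum
          intro σ _
          apply mul_le_mul_of_nonneg_right _ (by positivity)
          apply ih (i+1) _ _ (row_union U i hU σ)
          rw [add_assoc, add_comm 1 k]; exact hi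
      _ ≤ M * (n.factorial * Real.exp (b * i)) := by
          rw [← Finset.mul_sum]
          exact mul_le_mul_of_nonneg_left (sum_perm n i U hU b hb0) hM0
      _ = _ := by
          rw [hM, Finset.sum_range_succ', mul_add, Real.exp_add, pow_succ]
          have : ∑ j ∈ range k, (((i + 1 : ℕ):ℝ) + j) = ∑ j ∈ range k, ((i:ℝ) + (j+1:ℕ)) := by
            apply Finset.sum_congr rfl; intro j _; push_cast; ring
          rw [this]
          simp only [Nat.cast_zero, add_zero]
          ring

open Finset in
theorem mom_final (n m k : ℕ) (hm : m ≤ n ^ 2) (hk : 1 ≤ k) (hL : k * n < m) (E : ℝ)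
    (hE : ((n:ℝ)^2 - m) / ((m:ℝ) - k * n) - (n * n * (1 / (m:ℝ) - 1 / ((n:ℝ)^2 - k * n))) ≤ E)
    (hE2 : E * k ≤ 1) (hE0 : 0 ≤ E) :
    mom n m k ∅ ≤ (n^2).choose m * (meanX n m) ^ k * Real.exp k := by
  have h2 : (m:ℝ) ≤ (n:ℝ)^2 := by exact_mod_cast hm
  have h3 : (k:ℝ) * n < m := by exact_mod_cast hL
  have hnm : n ≤ m := by nlinarith
  have hb0 : 0 ≤ ((n:ℝ)^2 - m) / ((m:ℝ) - k * n) := by apply div_nonneg <;> linarith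
  set b := ((n:ℝ)^2 - m) / ((m:ℝ) - k * n) with hbdef
  have hb : 1 + b = (((n^2:ℕ):ℝ) - (k*n:ℕ)) / ((m:ℝ) - (k*n:ℕ)) := by
    rw [hbdef]; push_cast
    have : (m:ℝ) - k * n ≠ 0 := by linarith
    rw [one_add_div this]
    congr 1; ring
  have h := mom_le n m (k*n) hm hL b hb0 hb k 0 ∅ (by simp) (by simp)
  rw [card_empty, zero_add, ← mul_assoc] at h
  have hp : 0 < (1+b)^(k*n) := by positivity
  have h := le_of_mul_le_mul_right h hp
  have h5 := fr_mul_le (n^2) m n (k*n) hm hL k le_rfl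
  rw [meanX_eq n m hm hnm]
  set c := (n * n * (1 / (m:ℝ) - 1 / (((n^2:ℕ):ℝ) - (k*n:ℕ)))) with hc
  have hbc : b - c ≤ E := by rw [hc]; push_cast; exact hE
  simp only [Nat.cast_zero, zero_add] at h
  set s := ∑ j ∈ range k, (j:ℝ) with hs
  have hs0 : 0 ≤ s := Finset.sum_nonneg (fun _ _ => by positivity)
  have hs1 : s ≤ k * k := by
    calc s ≤ ∑ j ∈ range k, (k:ℝ) := Finset.sum_le_sum (fun j hj => by
            exact_mod_cast (Finset.mem_range.1 hj).le)
      _ = _ := by simp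
  have hexp : b * s + -c * s ≤ k := by
    have : (b - c) * s ≤ E * (k * k) :=
      (mul_le_mul_of_nonneg_right hbc hs0).trans (mul_le_mul_of_nonneg_left hs1 hE0)
    have : E * k * k ≤ 1 * k := by gcongr
    nlinarith
  calc _ ≤ _ := h
    _ ≤ (n.factorial:ℝ)^k * Real.exp (b * s) * ((n^2).choose m * (fr (n^2) m n ^ k * Real.exp (-c * s))) := by
        gcongr
    _ = (n^2).choose m * (n.factorial * fr (n^2) m n)^k * Real.exp (b * s + -c * s) := by
        rw [Real.exp_add]; ring
    _ ≤ _ := by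
        have := (fr_pos (n^2) m n hm hnm).le
        gcongr

open Finset in
theorem prob_le (n m k : ℕ) (hm : m ≤ n ^ 2) (hnm : n ≤ m) (hk : 1 ≤ k)
    (h : mom n m k ∅ ≤ (n^2).choose m * (meanX n m) ^ k * Real.exp k) :
    probX_ge n m (Real.exp 5 * meanX n m) ≤ Real.exp (-(4 * k)) := by
  have hc : (0:ℝ) < (n^2).choose m := by exact_mod_cast Nat.choose_pos hm
  have hmean : 0 < meanX n m := by
    rw [meanX_eq n m hm hnm]
    have := fr_pos (n^2) m n hm hnm
    positivity
  set A := (Finset.powersetCard m (Finset.univ : Finset (Fin n × Fin n))).filter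
      (fun S => Real.exp 5 * meanX n m ≤ (matchCount n S : ℝ)) with hA
  have h1 : (A.card : ℝ) * (Real.exp 5 * meanX n m)^k ≤ mom n m k ∅ := by
    calc (A.card : ℝ) * (Real.exp 5 * meanX n m)^k = ∑ S ∈ A, (Real.exp 5 * meanX n m)^k := by simp
      _ ≤ ∑ S ∈ A, (matchCount n S : ℝ)^k := by
          apply Finset.sum_le_sum
          intro S hS
          have := (mem_filter.1 hS).2
          gcongr
      _ ≤ mom n m k ∅ := by
          rw [mom]
          apply Finset.sum_le_sum_of_subset_of_nonneg
          · intro S hS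
            simp only [mem_filter, empty_subset, and_true]
            exact (mem_filter.1 hS).1
          · intros; positivity
  have h2 : probX_ge n m (Real.exp 5 * meanX n m) = A.card / (n^2).choose m := rfl
  rw [h2, div_le_iff₀ hc]
  have h3 := h1.trans h
  have hq : 0 < Real.exp (5 * k) * meanX n m ^ k := by positivity
  have e1 : (Real.exp 5 * meanX n m)^k = Real.exp (5 * k) * meanX n m ^ k := by
    rw [mul_pow, ← Real.exp_nat_mul]; ring_nf
  rw [e1] at h3
  refine le_of_mul_le_mul_right (h3.trans (le_of_eq ?_)) hq
  have : Real.exp k = Real.exp (-(4*k)) * Real.exp (5*k) := by rw [← Real.exp_add]; ring_nf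
  rw [this]; ring

theorem exponent_bound (p x k m : ℝ) (hp0 : 0 < p) (hp1 : p < 1) (hx : 0 < x) (hk : 0 ≤ k)
    (hm1 : p / 2 * x ^ 2 ≤ m) (hm2 : m ≤ x ^ 2) (hkm : k * x ≤ m / 2) :
    (x^2 - m) / (m - k * x) - (x * x * (1 / m - 1 / (x^2 - k * x))) ≤ (8 / p^2 + 2) * k / x := by
  have hm0 : 0 < m := lt_of_lt_of_le (by positivity) hm1
  have hd1 : 0 < m - k * x := by linarith
  have hd2 : 0 < x^2 - k * x := by linarith
  have e : (x^2 - m) / (m - k * x) - (x * x * (1 / m - 1 / (x^2 - k * x)))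
      = (x^2 - m) * (k * x) / (m * (m - k*x)) + k * x / (x^2 - k*x) := by
    have exx : x * x = x^2 := by ring
    rw [exx]
    generalize k * x = y at *
    generalize x^2 = z at *
    have := hm0.ne'
    have := hd1.ne'
    have := hd2.ne'
    field_simp
    ring
  rw [e]
  have hkx : 0 ≤ k * x := by positivity
  have h1 : (x^2 - m) * (k * x) / (m * (m - k*x)) ≤ 8 / p^2 * k / x := by
    calc _ ≤ x^2 * (k * x) / ((p/2*x^2) * (p / 4 * x^2)) := by
          gcongr
          · linarith
          · nlinarith
      _ = _ := by field_simp; ring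
  have h2 : k * x / (x^2 - k*x) ≤ 2 * k / x := by
    calc _ ≤ k * x / (x^2/2) := by
          gcongr
          linarith
      _ = _ := by field_simp
  calc _ ≤ 8 / p^2 * k / x + 2 * k / x := add_le_add h1 h2
    _ = _ := by ring

theorem eventually_log (C : ℝ) (hC : 0 < C) : ∃ N : ℕ, ∀ n : ℕ, N ≤ n → C * (Real.log n + 2)^2 ≤ n := by
  have h1 : (fun x : ℝ => (Real.log x + 2)^2) =o[Filter.atTop] (fun x : ℝ => x) := by
    have ha : (fun x : ℝ => Real.log x + 2) =o[Filter.atTop] (fun x : ℝ => x ^ (1/2:ℝ)) := by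
      apply Asymptotics.IsLittleO.add (isLittleO_log_rpow_atTop (by norm_num))
      apply Asymptotics.isLittleO_const_left.2
      right
      exact tendsto_norm_atTop_atTop.comp (tendsto_rpow_atTop (by norm_num))
    have hb := ha.pow (n := 2) (by norm_num)
    refine hb.trans_eventuallyEq ?_
    filter_upwards [Filter.eventually_ge_atTop 0] with x hx
    rw [← Real.rpow_natCast, ← Real.rpow_mul hx]; norm_num
  have h2 := (h1.comp_tendsto tendsto_natCast_atTop_atTop).bound (inv_pos.2 hC)
  obtain ⟨N, hN⟩ := Filter.eventually_atTop.1 h2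
  refine ⟨N, fun n hn => ?_⟩
  have := hN n hn
  simp only [Function.comp, Real.norm_eq_abs] at this
  rw [abs_of_nonneg (by positivity), abs_of_nonneg (by positivity), inv_mul_eq_div, le_div_iff₀ hC] at this
  linarith

/-- For `0 < p < 1` there are `K = K(p)` and `N` such that for all `n ≥ N` and all
`(p/2) n² ≤ m ≤ ((1+p)/2) n²` we have `P(X_{n,m} ≥ K E X_{n,m}) ≤ n⁻⁴`. -/
theorem upper_tail_bound (p : ℝ) (hp0 : 0 < p) (hp1 : p < 1) :
    ∃ K : ℝ, ∃ N : ℕ, ∀ n : ℕ, N ≤ n → ∀ m : ℕ,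
      p / 2 * (n : ℝ) ^ 2 ≤ (m : ℝ) → (m : ℝ) ≤ (1 + p) / 2 * (n : ℝ) ^ 2 →
      probX_ge n m (K * meanX n m) ≤ ((n : ℝ) ^ 4)⁻¹ := by
  obtain ⟨C, hC⟩ : ∃ C : ℝ, C = 8 / p^2 + 2 := ⟨_, rfl⟩
  have hC0 : 0 < C := by rw [hC]; positivity
  obtain ⟨N, hN⟩ := eventually_log C hC0
  refine ⟨Real.exp 5, max N 1, fun n hn m hm1 hm2 => ?_⟩
  have hn1 : 1 ≤ n := le_trans (le_max_right _ _) hn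
  have hlog := hN n (le_trans (le_max_left _ _) hn)
  have hx : (1:ℝ) ≤ n := by exact_mod_cast hn1
  have hlog0 : 0 ≤ Real.log n := Real.log_nonneg hx
  obtain ⟨k, hkdef⟩ : ∃ k : ℕ, k = ⌈Real.log n⌉₊ + 1 := ⟨_, rfl⟩
  have hk1 : 1 ≤ k := by omega
  have hk1' : (1:ℝ) ≤ k := by exact_mod_cast hk1
  have hkl : Real.log n ≤ k := by
    rw [hkdef]; push_cast
    have := Nat.le_ceil (Real.log n); linarith
  have hku : (k:ℝ) ≤ Real.log n + 2 := by
    rw [hkdef]; push_cast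
    have := Nat.ceil_lt_add_one hlog0; linarith
  have hCk : C * k ^ 2 ≤ n := le_trans (by gcongr) hlog
  have hCk1 : C * k ≤ n := le_trans (by nlinarith [mul_nonneg hC0.le (by linarith : (0:ℝ) ≤ k)]) hCk
  have hCp : 4 / p < C := by
    rw [hC]
    have : 4 / p ≤ 8 / p^2 := by
      rw [div_le_div_iff₀ hp0 (by positivity)]; nlinarith
    linarith
  have hkp : (k:ℝ) * 4 < p * n := by
    have h1 : 4 / p * k < n := lt_of_lt_of_le (by gcongr) hCk1
    have h2 : 4 / p * k = k * 4 / p := by ring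
    rw [h2, div_lt_iff₀ hp0] at h1
    linarith
  have hmn : (m:ℝ) ≤ (n:ℝ)^2 := hm2.trans (by nlinarith [sq_nonneg (n:ℝ)])
  have hmn' : m ≤ n^2 := by exact_mod_cast hmn
  have hkm : (k:ℝ) * n ≤ m / 2 := by nlinarith
  have hkn0 : 0 < (k:ℝ) * n := by positivity
  have hL : k * n < m := by
    have : (k:ℝ) * n < m := by linarith
    exact_mod_cast this
  have hnm : n ≤ m := by nlinarith
  have hE := exponent_bound p n k m hp0 hp1 (by linarith) (by linarith) hm1 hmn hkm
  rw [← hC] at hE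
  have hmom := mom_final n m k hmn' hk1 hL (C * k / n) hE
    (by rw [div_mul_eq_mul_div, div_le_one (by linarith)]; nlinarith) (by positivity)
  refine (prob_le n m k hmn' hnm hk1 hmom).trans ?_
  rw [Real.exp_neg]
  apply inv_anti₀ (by positivity)
  calc (n:ℝ)^4 = Real.exp (Real.log n) ^ 4 := by rw [Real.exp_log (by linarith)]
    _ = Real.exp (4 * Real.log n) := by rw [← Real.exp_nat_mul]; norm_num
    _ ≤ _ := by gcongr
end

section
/- For every ε > 0 there exists N such that the following holds for all n ≥ N: for all natural numbers k ≥ 2 and a ≥ 0 with k·a ≤ n/N, the number M(a) of ordered k-tuples (σ_1,…,σ_k) of permutations of [n] with |∪_{t=1}^k graph(σ_t)| = kn − a satisfies M(a) ≤ (1+ε)^k · exp(−k(k−1)/2) · (n!)^k · (k(k−1)/2)^a / a!. In particular, for sequences (k_n), (a_n) with k_n a_n = o(n), eventually M(a_n) ≤ 2^{k_n} exp(−k_n(k_n−1)/2) (n!)^{k_n} (k_n(k_n−1)/2)^{a_n} / a_n!. -/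
open Filter

/-- `M(a)`: the number of ordered `k`-tuples of permutations of `[n]` the union of whose
graphs has exactly `k·n - a` elements. -/
def Mcount (n k a : ℕ) : ℕ :=
  (Finset.univ.filter (fun σ : Fin k → Equiv.Perm (Fin n) =>
    (Finset.univ.biUnion
      (fun t : Fin k => Finset.univ.image (fun i : Fin n => (i, σ t i)))).card = k * n - a)).card


/-- `log (r!) / r`, with value `0` at `r = 0`. -/
noncomputable def breF (r : ℕ) : ℝ := Real.log (r.factorial : ℝ) / r

lemma breF_nonneg (r : ℕ) : 0 ≤ breF r := by
  unfold breF
  have : (1:ℝ) ≤ r.factorial := by exact_mod_cast Nat.factorial_pos r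
  have := Real.log_nonneg this
  positivity

lemma mul_breF (r : ℕ) : (r : ℝ) * breF r = Real.log (r.factorial : ℝ) := by
  unfold breF
  rcases Nat.eq_zero_or_pos r with h | h
  · subst h; simp
  · have : (r : ℝ) ≠ 0 := by positivity
    field_simp

lemma fiber_log {ι κ : Type*} [DecidableEq κ] (T : Finset ι) (f : ι → κ) (S : Finset κ)
    (h : ∀ x ∈ T, f x ∈ S) :
    (T.card : ℝ) * Real.log T.card ≤ T.card * Real.log S.card
      + ∑ x ∈ T, Real.log ((T.filter (fun y => f y = f x)).card : ℝ) := by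
  rcases T.eq_empty_or_nonempty with rfl | hT
  · simp
  have hS : 0 < S.card := by
    obtain ⟨x, hx⟩ := hT
    exact Finset.card_pos.2 ⟨_, h x hx⟩
  have hT' : 0 < T.card := Finset.card_pos.2 hT
  have hS' : (0:ℝ) < S.card := by exact_mod_cast hS
  have hT'' : (0:ℝ) < T.card := by exact_mod_cast hT'
  have key : ∀ x ∈ T, Real.log T.card - Real.log S.card
      - Real.log ((T.filter (fun y => f y = f x)).card : ℝ)
      ≤ (T.card : ℝ) / S.card * ((T.filter (fun y => f y = f x)).card : ℝ)⁻¹ - 1 := by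
    intro x hx
    have h1 : 0 < (T.filter (fun y => f y = f x)).card :=
      Finset.card_pos.2 ⟨x, by simp [hx]⟩
    have h2 : (0:ℝ) < ((T.filter (fun y => f y = f x)).card : ℝ) := by exact_mod_cast h1
    have := Real.log_le_sub_one_of_pos (x := (T.card : ℝ) / S.card *
      ((T.filter (fun y => f y = f x)).card : ℝ)⁻¹) (by positivity)
    rw [Real.log_mul (by positivity) (by positivity), Real.log_div (by positivity) (by positivity),
      Real.log_inv] at this
    linarith
  have hsum : ∑ x ∈ T, ((T.filter (fun y => f y = f x)).card : ℝ)⁻¹ ≤ S.card := by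
    rw [← Finset.sum_fiberwise_of_maps_to h]
    have : ∀ s ∈ S, ∑ x ∈ T with f x = s, ((T.filter (fun y => f y = f x)).card : ℝ)⁻¹ ≤ 1 := by
      intro s _
      have : ∑ x ∈ T with f x = s, ((T.filter (fun y => f y = f x)).card : ℝ)⁻¹
          = ∑ x ∈ T with f x = s, ((T.filter (fun y => f y = s)).card : ℝ)⁻¹ := by
        apply Finset.sum_congr rfl
        intro x hx
        rw [(Finset.mem_filter.1 hx).2]
      rw [this, Finset.sum_const, nsmul_eq_mul]
      exact mul_inv_le_one
    calc _ ≤ ∑ s ∈ S, (1:ℝ) := Finset.sum_le_sum this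
      _ = _ := by simp
  have h3 := Finset.sum_le_sum key
  simp only [Finset.sum_sub_distrib, Finset.sum_const, nsmul_eq_mul, ← Finset.mul_sum] at h3
  have h4 : (T.card : ℝ) / S.card * ∑ x ∈ T, ((T.filter (fun y => f y = f x)).card : ℝ)⁻¹
      ≤ T.card := by
    calc _ ≤ (T.card : ℝ) / S.card * S.card := by gcongr
      _ = _ := by field_simp
  linarith

/-- number of bijections compatible with `R` (a permanent) -/
noncomputable def perC {α β : Type} (R : α → β → Prop) : ℕ :=
  Nat.card {e : α ≃ β // ∀ i, R i (e i)}

/-- row sum -/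
noncomputable def rowC {α β : Type} (R : α → β → Prop) (i : α) : ℕ := Nat.card {b : β // R i b}

lemma rowC_restrict {α β : Type} [Finite β] (R : α → β → Prop) (j : α) (k : β) [Decidable (R j k)] :
    Nat.card {b : {b : β // b ≠ k} // R j b} = rowC R j - (if R j k then 1 else 0) := by
  classical
  cases nonempty_fintype β
  unfold rowC
  rw [Nat.card_congr (Equiv.subtypeSubtypeEquivSubtypeInter (fun b => b ≠ k) (R j))]
  rw [Nat.card_eq_fintype_card, Nat.card_eq_fintype_card, Fintype.card_subtype,
    Fintype.card_subtype]
  have : (Finset.univ.filter fun b => b ≠ k ∧ R j b) = (Finset.univ.filter (R j)).erase k := by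
    ext b; simp
  rw [this, Finset.card_erase_eq_ite]
  split_ifs <;> simp_all

theorem bregman (n : ℕ) : ∀ (α β : Type) [Finite α] [Finite β] (R : α → β → Prop)
    [Fintype α], Fintype.card α = n →
    Real.log (perC R : ℝ) ≤ ∑ i, breF (rowC R i) := by
  classical
  induction n with
  | zero =>
    intro α β _ _ R _ hα
    have := Fintype.card_eq_zero_iff.1 hα
    have hs : Subsingleton {e : α ≃ β // ∀ i, R i (e i)} :=
      ⟨fun a b => Subtype.ext (Equiv.ext fun i => (this.false i).elim)⟩
    have h1 : perC R ≤ 1 := Finite.card_le_one_iff_subsingleton.2 hs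
    have : Real.log (perC R : ℝ) = 0 := by
      interval_cases perC R <;> simp
    rw [this]
    exact Finset.sum_nonneg fun i _ => breF_nonneg _
  | succ n ih =>
    intro α β _ _ R _ hα
    cases nonempty_fintype β
    set T : Finset (α ≃ β) := Finset.univ.filter (fun e => ∀ i, R i (e i)) with hTdef
    have hP : perC R = T.card := by
      unfold perC
      rw [Nat.card_eq_fintype_card, Fintype.card_subtype]
    rw [hP]
    rcases T.eq_empty_or_nonempty with hT | hT
    · rw [hT]; simpa using Finset.sum_nonneg fun i _ => breF_nonneg _
    have hrow : ∀ i, rowC R i = (Finset.univ.filter (R i)).card := by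
      intro i
      unfold rowC
      rw [Nat.card_eq_fintype_card, Fintype.card_subtype]
    have hT0 : (0:ℝ) < T.card := by exact_mod_cast Finset.card_pos.2 hT
    have step1 : ∀ i, (T.card : ℝ) * Real.log T.card ≤ T.card * Real.log (rowC R i)
      + ∑ x ∈ T, Real.log ((T.filter (fun y => y i = x i)).card : ℝ) := by
      intro i
      rw [hrow i]
      apply fiber_log T (fun e => e i)
      intro x hx
      simp only [hTdef, Finset.mem_filter, Finset.mem_univ, true_and] at hx ⊢
      exact hx i
    have step2 : ∀ i k, T.filter (fun y => y i = k) ≠ ∅ →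
        Real.log ((T.filter (fun y => y i = k)).card : ℝ)
        ≤ ∑ j ∈ Finset.univ.erase i, breF (rowC R j - (if R j k then 1 else 0)) := by
      intro i k hne
      have h1 := ih {a : α // a ≠ i} {b : β // b ≠ k} (fun a b => R a b) (by
        rw [Fintype.card_subtype_compl, Fintype.card_subtype_eq, hα]; simp)
      have h2 : ∑ a : {a : α // a ≠ i}, breF (rowC (fun (a : {a : α // a ≠ i})
          (b : {b : β // b ≠ k}) => R a b) a)
          = ∑ j ∈ Finset.univ.erase i, breF (rowC R j - (if R j k then 1 else 0)) := by
        have e1 : ∀ a : {a : α // a ≠ i}, rowC (fun (a : {a : α // a ≠ i})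
          (b : {b : β // b ≠ k}) => R a b) a = rowC R a - (if R a k then 1 else 0) :=
          fun a => rowC_restrict R a k
        simp_rw [e1]
        rw [← Finset.sum_subtype (p := fun a => a ≠ i) (Finset.univ.erase i) (by simp)
          (fun j => breF (rowC R j - (if R j k then 1 else 0)))]
      rw [h2] at h1
      refine le_trans ?_ h1
      apply Real.log_le_log
      · exact_mod_cast Finset.card_pos.2 (Finset.nonempty_iff_ne_empty.2 hne)
      · norm_cast
        rw [← Fintype.card_coe, ← Nat.card_eq_fintype_card]
        unfold perC
        have hmem : ∀ y : {y // y ∈ T.filter (fun y => y i = k)}, y.1 i = k ∧ ∀ j, R j (y.1 j) := by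
          rintro ⟨y, hy⟩
          simp only [hTdef, Finset.mem_filter, Finset.mem_univ, true_and] at hy
          exact ⟨hy.2, hy.1⟩
        refine Nat.card_le_card_of_injective (fun y =>
          ⟨y.1.subtypeEquiv (fun a => not_congr ⟨fun h => by rw [h]; exact (hmem y).1,
            fun h => y.1.injective (h.trans (hmem y).1.symm)⟩), fun a => ?_⟩) ?_
        · simpa using (hmem y).2 a
        · intro y y' hyy
          apply Subtype.ext
          apply Equiv.ext
          intro a
          by_cases ha : a = i
          · subst ha; rw [(hmem y).1, (hmem y').1]
          · have := congrArg (fun e => ((e.1 ⟨a, ha⟩ : {b : β // b ≠ k}) : β)) hyy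
            simpa using this
    have step3 : ∀ x ∈ T, ∑ i, Real.log ((T.filter (fun y => y i = x i)).card : ℝ)
        ≤ ∑ j, ((n + 1 : ℝ) * breF (rowC R j) - Real.log (rowC R j)) := by
      intro x hx
      have hxR : ∀ i, R i (x i) := by simpa [hTdef] using hx
      calc _ ≤ ∑ i, ∑ j ∈ Finset.univ.erase i, breF (rowC R j - (if R j (x i) then 1 else 0)) := by
            apply Finset.sum_le_sum
            intro i _
            apply step2
            exact Finset.nonempty_iff_ne_empty.1 ⟨x, by simp [hx]⟩
        _ = ∑ j, ∑ i ∈ Finset.univ.erase j, breF (rowC R j - (if R j (x i) then 1 else 0)) := by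
            apply Finset.sum_comm'
            intro a b; simp [eq_comm]
        _ = _ := by
            apply Finset.sum_congr rfl
            intro j _
            have hc : (Finset.univ.filter (fun i => R j (x i))).card = rowC R j := by
              rw [hrow, ← Finset.card_map x.toEmbedding]
              congr 1
              ext b
              simp only [Finset.mem_map, Finset.mem_filter, Finset.mem_univ, true_and]
              constructor
              · rintro ⟨a, ha, rfl⟩; exact ha
              · intro hb; exact ⟨x.symm b, by simpa using hb, by simp⟩
            have hr : 1 ≤ rowC R j := by
              rw [← hc]; exact Finset.card_pos.2 ⟨j, by simpa using hxR j⟩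
            obtain ⟨r, hr'⟩ : ∃ r, rowC R j = r + 1 := ⟨rowC R j - 1, by omega⟩
            have e0 : ∑ i, breF (rowC R j - (if R j (x i) then 1 else 0))
              = breF (rowC R j - 1) + ∑ i ∈ Finset.univ.erase j, breF (rowC R j - (if R j (x i) then 1 else 0)) := by
              rw [← Finset.add_sum_erase _ _ (Finset.mem_univ j), if_pos (hxR j)]
            have e1 : ∑ i, breF (rowC R j - (if R j (x i) then 1 else 0))
              = rowC R j * breF (rowC R j - 1) + ((n + 1 : ℝ) - rowC R j) * breF (rowC R j) := by
              have : ∀ i, breF (rowC R j - (if R j (x i) then 1 else 0))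
                = (if R j (x i) then (breF (rowC R j - 1) - breF (rowC R j)) else 0) + breF (rowC R j) := by
                intro i; split_ifs <;> simp
              simp_rw [this]
              rw [Finset.sum_add_distrib, ← Finset.sum_filter, Finset.sum_const, Finset.sum_const,
                hc, Finset.card_univ, hα]
              simp only [nsmul_eq_mul]
              push_cast
              ring
            have e2 := mul_breF r
            have e3 := mul_breF (r + 1)
            rw [Nat.factorial_succ] at e3
            push_cast at e3
            rw [Real.log_mul (by positivity) (by positivity)] at e3
            rw [hr'] at e0 e1 ⊢
            simp only [Nat.add_sub_cancel] at e0 e1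
            push_cast at e1 ⊢
            linarith
    have hA := Finset.sum_le_sum (fun i (_ : i ∈ Finset.univ) => step1 i)
    rw [Finset.sum_add_distrib, Finset.sum_comm, Finset.sum_const, Finset.card_univ, hα,
      ← Finset.mul_sum] at hA
    have hB := Finset.sum_le_sum step3
    rw [Finset.sum_const, Finset.sum_sub_distrib, ← Finset.mul_sum] at hB
    simp only [nsmul_eq_mul] at hA hB
    push_cast at hA
    have hC : ((n:ℝ)+1) * T.card * Real.log T.card ≤ ((n:ℝ)+1) * T.card * ∑ i, breF (rowC R i) := by
      nlinarith
    exact le_of_mul_le_mul_left hC (by positivity)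

/-- `log r! - r log r + r` -/
noncomputable def stS (r : ℕ) : ℝ := Real.log (r.factorial : ℝ) - r * Real.log r + r

lemma stS_succ (r : ℕ) (hr : 1 ≤ r) : stS (r+1) - stS r = 1 - r * (Real.log (r+1) - Real.log r) := by
  unfold stS
  rw [Nat.factorial_succ]
  push_cast
  rw [Real.log_mul (by positivity) (by positivity)]
  ring

lemma log_diff_le (r : ℕ) (hr : 1 ≤ r) : r * (Real.log (r+1) - Real.log r) ≤ 1 := by
  have h0 : (0:ℝ) < r := by exact_mod_cast hr
  have := Real.log_le_sub_one_of_pos (x := ((r:ℝ)+1)/r) (by positivity)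
  rw [Real.log_div (by positivity) (by positivity)] at this
  calc _ ≤ r * (((r:ℝ)+1)/r - 1) := by gcongr
    _ = 1 := by field_simp; ring

lemma le_log_diff (r : ℕ) (hr : 1 ≤ r) : 1 ≤ (r + 1) * (Real.log (r+1) - Real.log r) := by
  have h0 : (0:ℝ) < r := by exact_mod_cast hr
  have := Real.log_le_sub_one_of_pos (x := (r:ℝ)/(r+1)) (by positivity)
  rw [Real.log_div (by positivity) (by positivity)] at this
  calc 1 = ((r:ℝ) + 1) * (1 - (r:ℝ)/(r+1)) := by field_simp; ring
    _ ≤ _ := mul_le_mul_of_nonneg_left (by linarith) (by positivity)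

lemma stS_mono {r n : ℕ} (hr : 1 ≤ r) (h : r ≤ n) : stS r ≤ stS n := by
  induction n, h using Nat.le_induction with
  | base => exact le_rfl
  | succ m hm ih =>
    have := stS_succ m (by omega)
    have := log_diff_le m (by omega)
    linarith

lemma stS_le {r : ℕ} (hr : 1 ≤ r) : stS r ≤ 1 + Real.log r := by
  induction r, hr using Nat.le_induction with
  | base => simp [stS]
  | succ m hm ih =>
    have := stS_succ m (by omega)
    have := le_log_diff m (by omega)
    push_cast
    linarith

lemma breF_eq {r : ℕ} (hr : 1 ≤ r) : breF r = Real.log r - 1 + stS r / r := by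
  have h0 : (0:ℝ) < r := by exact_mod_cast hr
  unfold breF stS
  field_simp
  ring

lemma breF_diff {r n : ℕ} (hr : 1 ≤ r) (h : r ≤ n) :
    breF r - breF n ≤ Real.log (r / n : ℝ) + (1 + Real.log r) * (n - r) / (r * n) := by
  have h0 : (0:ℝ) < r := by exact_mod_cast hr
  have h1 : (0:ℝ) < n := by exact_mod_cast (by omega : 0 < n)
  have hrn : (r:ℝ) ≤ n := by exact_mod_cast h
  rw [breF_eq hr, breF_eq (hr.trans h), Real.log_div h0.ne' h1.ne']
  have e1 : stS r / n ≤ stS n / n := by gcongr; exact stS_mono hr h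
  have e2 : stS r / r - stS r / n = stS r * (n - r) / (r * n) := by field_simp
  have e3 : stS r * (n - r) / (r * n) ≤ (1 + Real.log r) * (n - r) / (r * n) := by
    have := stS_le hr
    have : (0:ℝ) ≤ n - r := by linarith
    gcongr
  linarith

lemma log_one_sub_le (t : ℝ) (h0 : 0 ≤ t) (h1 : t < 1) : Real.log (1 - t) ≤ - t - t^2/2 := by
  have h := Real.hasSum_pow_div_log_of_abs_lt_one (x := t) (by rw [abs_of_nonneg h0]; exact h1)
  have := h.summable.sum_le_tsum (Finset.range 2) (fun i _ => by positivity)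
  rw [h.tsum_eq] at this
  simp [Finset.sum_range_succ] at this
  norm_num at this
  linarith

lemma half_case {x : ℝ} (h0 : 0 < x) (h1 : x ≤ 1/2) : Real.log x + 1 - x ≤ -(19/100) := by
  have h2 := Real.log_le_sub_one_of_pos (x := 2 * x) (by positivity)
  rw [Real.log_mul (by norm_num) h0.ne'] at h2
  have := Real.log_two_gt_d9
  linarith

lemma pointwise (δ : ℝ) (hδ : 0 < δ) : ∃ n0 : ℕ, ∀ n, n0 ≤ n → ∀ r : ℕ, 1 ≤ r → r ≤ n →
    breF r ≤ breF n - (n - r) / n + δ / n := by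
  have t1 : Tendsto (fun n : ℕ => (1 + Real.log n) / n) atTop (nhds 0) := by
    have a1 : Tendsto (fun n : ℕ => Real.log n / (n:ℝ)) atTop (nhds 0) :=
      (Real.isLittleO_log_id_atTop.tendsto_div_nhds_zero).comp tendsto_natCast_atTop_atTop
    have a2 : Tendsto (fun n : ℕ => 1 / (n:ℝ)) atTop (nhds 0) := tendsto_one_div_atTop_nhds_zero_nat
    simpa [add_div] using a2.add a1
  have t2 : Tendsto (fun n : ℕ => 2 * (1 + Real.log n) ^ 2 / n) atTop (nhds 0) := by
    have a1 : Tendsto (fun x : ℝ => 2 * (1 + Real.log x) ^ 2 / x) atTop (nhds 0) := by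
      have b0 : (fun x : ℝ => (1:ℝ)) =o[atTop] (fun x => x) := Asymptotics.isLittleO_const_id_atTop 1
      have b1 := Real.isLittleO_log_id_atTop
      have b2 : (fun x : ℝ => Real.log x ^ 2) =o[atTop] (fun x => x) := by
        exact Real.isLittleO_pow_log_id_atTop (n := 2)
      have b3 : (fun x : ℝ => 2 * (1 + Real.log x) ^ 2) =o[atTop] (fun x => x) := by
        have := (b0.const_mul_left 2).add ((b1.const_mul_left 4).add (b2.const_mul_left 2))
        refine this.congr_left ?_
        intro x; simp; ring
      exact b3.tendsto_div_nhds_zero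
    exact a1.comp tendsto_natCast_atTop_atTop
  obtain ⟨R0, hR0⟩ := eventually_atTop.1 (t1.eventually (gt_mem_nhds (show (0:ℝ) < 19/100 by norm_num)))
  obtain ⟨n1, hn1⟩ := eventually_atTop.1 (t2.eventually (gt_mem_nhds hδ))
  have t3 : Tendsto (fun n : ℕ => Real.log n) atTop atTop :=
    Real.tendsto_log_atTop.comp tendsto_natCast_atTop_atTop
  obtain ⟨n2, hn2⟩ := eventually_atTop.1 (t3.eventually_ge_atTop (R0 + 2 : ℝ))
  refine ⟨max n1 (max n2 1), fun n hn r hr hrn => ?_⟩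
  have g1 := hn1 n (by omega)
  have g2 := hn2 n (by omega)
  have h0 : (0:ℝ) < r := by exact_mod_cast hr
  have hr1 : (1:ℝ) ≤ r := by exact_mod_cast hr
  have h1 : (0:ℝ) < n := by exact_mod_cast (by omega : 0 < n)
  have hrn' : (r:ℝ) ≤ n := by exact_mod_cast hrn
  have hd := breF_diff hr hrn
  have hlogr : 0 ≤ Real.log r := Real.log_nonneg hr1
  have hδn : 0 < δ / n := by positivity
  have hfr : ((n:ℝ) - r) / n = 1 - r / n := by field_simp
  by_cases hhalf : (n:ℝ) ≤ 2 * r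
  · have k1 := log_one_sub_le (((n:ℝ) - r) / n) (div_nonneg (by linarith) h1.le)
      (by rw [div_lt_one h1]; linarith)
    have k2 : 1 - ((n:ℝ) - r)/n = r / n := by field_simp; ring
    rw [k2] at k1
    have k3 : (1 + Real.log r) * (n - r) / (r * n) ≤ 2 * (1 + Real.log n) * (((n:ℝ) - r) / n) / n := by
      have : Real.log r ≤ Real.log n := Real.log_le_log h0 hrn'
      calc (1 + Real.log r) * (n - r) / (r * n) ≤ (1 + Real.log n) * (n - r) / ((n/2) * n) := by
            have : (0:ℝ) ≤ n - r := by linarith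
            gcongr
            linarith
        _ = _ := by field_simp
    set t := ((n:ℝ) - r) / n
    have k4 : 2 * (1 + Real.log n) * t / n - t^2/2 ≤ 2 * ((1 + Real.log n)/n)^2 := by
      have : 2 * (1 + Real.log n) * t / n = 2 * ((1 + Real.log n)/n) * t := by ring
      rw [this]
      nlinarith [sq_nonneg (t - 2 * ((1 + Real.log n)/n))]
    have k5 : 2 * ((1 + Real.log n)/n)^2 ≤ δ / n := by
      have : 2 * ((1 + Real.log n)/n)^2 = (2 * (1 + Real.log n) ^ 2 / n) / n := by field_simp
      rw [this]
      gcongr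
    linarith
  · push Not at hhalf
    have k1 : (1 + Real.log r) * (n - r) / (r * n) ≤ (1 + Real.log r) / r := by
      rw [div_le_div_iff₀ (by positivity) h0]
      have : (1 + Real.log r) * (n - r) * r ≤ (1 + Real.log r) * n * r := by
        gcongr
        linarith
      linarith
    rw [hfr]
    by_cases hR : R0 ≤ r
    · have k2 := hR0 r hR
      have k3 := half_case (x := (r:ℝ)/n) (by positivity) (by rw [div_le_div_iff₀ h1 (by norm_num)]; linarith)
      linarith
    · have k2 : (1 + Real.log r) / r ≤ 1 := by
        rw [div_le_one h0]
        have := Real.log_le_sub_one_of_pos h0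
        linarith
      have k3 : Real.log r ≤ R0 := by
        have := Real.log_le_sub_one_of_pos h0
        have : (r:ℝ) ≤ R0 := by exact_mod_cast (by omega : r ≤ R0)
        linarith
      rw [Real.log_div h0.ne' h1.ne'] at hd
      have : 0 < (r:ℝ)/n := by positivity
      linarith

lemma perC_le (ε : ℝ) (hε : 0 < ε) : ∃ m0 : ℕ, ∀ m, m0 ≤ m → ∀ (α β : Type) [Fintype α] [Fintype β]
    (R : α → β → Prop), Fintype.card α = m → Fintype.card β = m →
    (perC R : ℝ) ≤ (1 + ε) * m.factorial * Real.exp (-((∑ i, ((m:ℝ) - rowC R i)) / m)) := by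
  obtain ⟨n0, hn0⟩ := pointwise (Real.log (1 + ε)) (Real.log_pos (by linarith))
  refine ⟨max n0 1, fun m hm α β _ _ R hα hβ => ?_⟩
  rcases Nat.eq_zero_or_pos (perC R) with h0 | h0
  · rw [h0]; push_cast; positivity
  have hm0 : (0:ℝ) < m := by exact_mod_cast (by omega : 0 < m)
  have hpos : (0:ℝ) < perC R := by exact_mod_cast h0
  have hb := bregman m α β R hα
  obtain ⟨⟨e, he⟩⟩ := (Nat.card_pos_iff.1 h0).1
  have h1 : ∀ i, breF (rowC R i) ≤ breF m - (m - rowC R i) / m + Real.log (1 + ε) / m := by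
    intro i
    apply hn0 m (by omega)
    · exact Nat.card_pos_iff.2 ⟨⟨⟨e i, he i⟩⟩, inferInstance⟩
    · unfold rowC
      rw [← hβ, ← Nat.card_eq_fintype_card]
      exact Finite.card_subtype_le _
  have h2 := hb.trans (Finset.sum_le_sum fun i _ => h1 i)
  rw [Finset.sum_add_distrib, Finset.sum_sub_distrib, Finset.sum_const, Finset.sum_const,
    Finset.card_univ, hα, nsmul_eq_mul, nsmul_eq_mul, mul_breF, mul_div_cancel₀ _ hm0.ne',
    ← Finset.sum_div] at h2
  have h3 := (Real.log_le_iff_le_exp hpos).1 h2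
  rw [Real.exp_add, sub_eq_add_neg, Real.exp_add, Real.exp_log (by positivity),
    Real.exp_log (by linarith)] at h3
  linarith

/-- rows `j` where `σ` hits `U` -/
def hitS {n : ℕ} (U : Finset (Fin n × Fin n)) (σ : Equiv.Perm (Fin n)) : Finset (Fin n) :=
  Finset.univ.filter (fun j => (j, σ j) ∈ U)

lemma rest_card {n i : ℕ} (U : Finset (Fin n × Fin n))
    (hrow : ∀ a, (U.filter (fun p => p.1 = a)).card ≤ i)
    (hcol : ∀ v, (U.filter (fun p => p.2 = v)).card ≤ i) (B V : Finset (Fin n)) :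
    U.card ≤ B.card * i + V.card * i + (U.filter (fun p => p.1 ∉ B ∧ p.2 ∉ V)).card := by
  have h1 : (U.filter (fun p => p.1 ∈ B)).card ≤ B.card * i := by
    rw [mul_comm]
    apply Finset.card_le_mul_card_image_of_maps_to (f := Prod.fst) (by simp)
    intro b _
    refine le_trans (Finset.card_le_card ?_) (hrow b)
    intro p; simp only [Finset.mem_filter]; tauto
  have h2 : (U.filter (fun p => p.2 ∈ V)).card ≤ V.card * i := by
    rw [mul_comm]
    apply Finset.card_le_mul_card_image_of_maps_to (f := Prod.snd) (by simp)
    intro b _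
    refine le_trans (Finset.card_le_card ?_) (hcol b)
    intro p; simp only [Finset.mem_filter]; tauto
  have h3 : U ⊆ (U.filter (fun p => p.1 ∈ B) ∪ U.filter (fun p => p.2 ∈ V))
      ∪ U.filter (fun p => p.1 ∉ B ∧ p.2 ∉ V) := by
    intro p; simp only [Finset.mem_filter, Finset.mem_union]; tauto
  have h4 := Finset.card_le_card h3
  have h5 := Finset.card_union_le (U.filter (fun p => p.1 ∈ B) ∪ U.filter (fun p => p.2 ∈ V))
      (U.filter (fun p => p.1 ∉ B ∧ p.2 ∉ V))
  have h6 := Finset.card_union_le (U.filter (fun p => p.1 ∈ B)) (U.filter (fun p => p.2 ∈ V))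
  omega

lemma fiber_le {n : ℕ} (U : Finset (Fin n × Fin n)) (σ₀ : Equiv.Perm (Fin n)) :
    (Finset.univ.filter (fun σ : Equiv.Perm (Fin n) => hitS U σ = hitS U σ₀ ∧
      ∀ j ∈ hitS U σ₀, σ j = σ₀ j)).card ≤
    perC (fun (a : {a // a ∉ hitS U σ₀}) (v : {v // v ∉ (hitS U σ₀).map σ₀.toEmbedding}) =>
      (a.1, v.1) ∉ U) := by
  classical
  rw [← Fintype.card_coe, ← Nat.card_eq_fintype_card]
  unfold perC
  set B := hitS U σ₀ with hB
  have hmem : ∀ y : {y // y ∈ Finset.univ.filter (fun σ : Equiv.Perm (Fin n) => hitS U σ = B ∧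
      ∀ j ∈ B, σ j = σ₀ j)}, hitS U y.1 = B ∧ ∀ j ∈ B, y.1 j = σ₀ j := by
    rintro ⟨y, hy⟩
    simpa using hy
  have hmap : ∀ y : {y // y ∈ Finset.univ.filter (fun σ : Equiv.Perm (Fin n) => hitS U σ = B ∧
      ∀ j ∈ B, σ j = σ₀ j)}, B.map σ₀.toEmbedding = B.map y.1.toEmbedding := by
    intro y
    ext v
    simp only [Finset.mem_map, Equiv.coe_toEmbedding]
    constructor
    · rintro ⟨a, ha, rfl⟩; exact ⟨a, ha, (hmem y).2 a ha⟩
    · rintro ⟨a, ha, rfl⟩; exact ⟨a, ha, ((hmem y).2 a ha).symm⟩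
  refine Nat.card_le_card_of_injective (fun y =>
    ⟨y.1.subtypeEquiv (fun a => by rw [hmap y]; simp), fun a => ?_⟩) ?_
  · have h1 := (hmem y).1
    have h2 : a.1 ∉ hitS U y.1 := by rw [h1]; exact a.2
    simpa [hitS] using h2
  · intro y y' hyy
    apply Subtype.ext
    apply Equiv.ext
    intro a
    by_cases ha : a ∈ B
    · rw [(hmem y).2 a ha, (hmem y').2 a ha]
    · have := congrArg (fun e => ((e.1 ⟨a, ha⟩ : {v // v ∉ B.map σ₀.toEmbedding}) : Fin n)) hyy
      simpa using this

lemma zero_sum {n : ℕ} (U : Finset (Fin n × Fin n)) (B V : Finset (Fin n)) (m : ℕ)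
    (hV : V.card + m = n) :
    ((U.filter (fun p => p.1 ∉ B ∧ p.2 ∉ V)).card : ℝ) ≤
      ∑ a : {a // a ∉ B}, ((m:ℝ) - rowC (fun (a : {a // a ∉ B}) (v : {v // v ∉ V}) =>
      (a.1, v.1) ∉ U) a) := by
  classical
  have h1 : (U.filter (fun p => p.1 ∉ B ∧ p.2 ∉ V)).card
      = ∑ a : {a // a ∉ B}, ((U.filter (fun p => p.1 ∉ B ∧ p.2 ∉ V)).filter (fun p => p.1 = a.1)).card := by
    rw [Finset.card_eq_sum_card_fiberwise (f := Prod.fst) (t := Bᶜ)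
      (by intro p hp; simp at hp ⊢; exact hp.2.1)]
    rw [Finset.sum_subtype (p := fun a => a ∉ B) (Bᶜ) (by simp)]
  rw [h1]
  push_cast
  apply Finset.sum_le_sum
  intro a _
  have h2 : ((U.filter (fun p => p.1 ∉ B ∧ p.2 ∉ V)).filter (fun p => p.1 = a.1)).card
      ≤ (Vᶜ.filter (fun v => (a.1, v) ∈ U)).card := by
    apply Finset.card_le_card_of_injOn Prod.snd
    · intro p hp
      simp only [Finset.coe_filter, Finset.mem_filter, Finset.mem_compl, Set.mem_ofPred_eq] at hp ⊢
      obtain ⟨⟨h, h', h''⟩, e⟩ := hp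
      exact ⟨h'', by rw [← e]; exact h⟩
    · intro p hp q hq hpq
      simp only [Finset.coe_filter, Finset.mem_filter, Set.mem_ofPred_eq] at hp hq
      exact Prod.ext (hp.2.trans hq.2.symm) hpq
  have h3 : rowC (fun (a : {a // a ∉ B}) (v : {v // v ∉ V}) => (a.1, v.1) ∉ U) a
      = (Vᶜ.filter (fun v => ¬ (a.1, v) ∈ U)).card := by
    unfold rowC
    rw [Nat.card_congr (Equiv.subtypeSubtypeEquivSubtypeInter (fun v => v ∉ V) (fun v => (a.1, v) ∉ U)),
      Nat.card_eq_fintype_card, Fintype.card_subtype]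
    congr 1
    ext v; simp
  have h4 := Finset.card_filter_add_card_filter_not (s := Vᶜ) (fun v => (a.1, v) ∈ U)
  rw [Finset.card_compl, Fintype.card_fin] at h4
  rw [h3, le_sub_iff_add_le]
  norm_cast
  omega

lemma hits_le (ε : ℝ) (hε : 0 < ε) : ∃ m0 : ℕ, ∀ n b i : ℕ, m0 + b ≤ n →
    ∀ (U : Finset (Fin n × Fin n)),
    (∀ a, (U.filter (fun p => p.1 = a)).card ≤ i) →
    (∀ v, (U.filter (fun p => p.2 = v)).card ≤ i) →
    ((Finset.univ.filter (fun σ : Equiv.Perm (Fin n) => (hitS U σ).card = b)).card : ℝ)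
      ≤ (1 + ε) * n.factorial * (i:ℝ) ^ b / b.factorial
        * Real.exp (-(((U.card : ℝ) - 2 * b * i) / n)) := by
  classical
  obtain ⟨m0, hm0⟩ := perC_le ε hε
  refine ⟨m0 + 1, fun n b i hn U hrow hcol => ?_⟩
  obtain ⟨m, hm⟩ : ∃ m, n = m + b := ⟨n - b, by omega⟩
  have hmpos : (0:ℝ) < m := by exact_mod_cast (by omega : 0 < m)
  have hmn : (m:ℝ) ≤ n := by exact_mod_cast (by omega : m ≤ n)
  set E := Real.exp (-(((U.card : ℝ) - 2 * b * i) / n)) with hE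
  have fib : ∀ σ₀ : Equiv.Perm (Fin n), (hitS U σ₀).card = b →
    ((Finset.univ.filter (fun σ : Equiv.Perm (Fin n) => hitS U σ = hitS U σ₀ ∧
      ∀ j ∈ hitS U σ₀, σ j = σ₀ j)).card : ℝ) ≤ (1 + ε) * m.factorial * E := by
    intro σ₀ hσ
    have h1 := fiber_le U σ₀
    set B := hitS U σ₀
    set V := B.map σ₀.toEmbedding with hVdef
    have hV : V.card = b := by rw [hVdef, Finset.card_map, hσ]
    have h2 := hm0 m (by omega) {a // a ∉ B} {v // v ∉ V} (fun a v => (a.1, v.1) ∉ U)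
      (by rw [Fintype.card_subtype_compl]; simp [hσ]; omega)
      (by rw [Fintype.card_subtype_compl]; simp [hV]; omega)
    have h3 := zero_sum U B V m (by omega)
    have h4 := rest_card U hrow hcol B V
    rw [hσ, hV] at h4
    have h4' : (U.card : ℝ) - 2 * b * i ≤ ((U.filter (fun p => p.1 ∉ B ∧ p.2 ∉ V)).card : ℝ) := by
      have : (U.card : ℝ) ≤ b * i + b * i + ((U.filter (fun p => p.1 ∉ B ∧ p.2 ∉ V)).card : ℝ) := by
        exact_mod_cast h4
      linarith
    refine le_trans (by exact_mod_cast h1) (h2.trans ?_)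
    rw [hE]
    refine mul_le_mul_of_nonneg_left (Real.exp_le_exp.2 (neg_le_neg ?_)) (by positivity)
    have hz : (0:ℝ) ≤ ((U.filter (fun p => p.1 ∉ B ∧ p.2 ∉ V)).card : ℝ) := by positivity
    calc ((U.card : ℝ) - 2 * b * i) / n ≤ ((U.filter (fun p => p.1 ∉ B ∧ p.2 ∉ V)).card : ℝ) / n := by gcongr
      _ ≤ ((U.filter (fun p => p.1 ∉ B ∧ p.2 ∉ V)).card : ℝ) / m := by gcongr
      _ ≤ _ := by gcongr
  let rowS : Fin n → Finset (Fin n) := fun a => Finset.univ.filter (fun v => (a, v) ∈ U)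
  have hrowS : ∀ a, (rowS a).card ≤ i := by
    intro a
    refine le_trans (Finset.card_le_card_of_injOn (fun v => (a, v)) ?_ ?_) (hrow a)
    · intro v hv; simpa [rowS] using hv
    · intro v _ w _ h; exact (Prod.ext_iff.1 h).2
  let t : Finset (Σ B : Finset (Fin n), (∀ a ∈ B, Fin n)) :=
    (Finset.powersetCard b Finset.univ).sigma (fun B => B.pi rowS)
  have ht : (t.card : ℝ) ≤ n.choose b * (i:ℝ)^b := by
    norm_cast
    rw [Finset.card_sigma]
    calc _ ≤ ∑ B ∈ Finset.powersetCard b (Finset.univ : Finset (Fin n)), i ^ b := by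
          apply Finset.sum_le_sum
          intro B hB
          rw [Finset.card_pi]
          rw [← (Finset.mem_powersetCard.1 hB).2]
          exact Finset.prod_le_pow_card _ _ _ (fun a _ => hrowS a)
      _ = _ := by rw [Finset.sum_const, Finset.card_powersetCard]; simp
  let f : Equiv.Perm (Fin n) → (Σ B : Finset (Fin n), (∀ a ∈ B, Fin n)) :=
    fun σ => ⟨hitS U σ, fun a _ => σ a⟩
  have hmaps : ∀ σ ∈ Finset.univ.filter (fun σ : Equiv.Perm (Fin n) => (hitS U σ).card = b),
      f σ ∈ t := by
    intro σ hσ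
    simp only [Finset.mem_filter, Finset.mem_univ, true_and] at hσ
    simp only [t, f, Finset.mem_sigma, Finset.mem_powersetCard, Finset.mem_pi]
    refine ⟨⟨Finset.subset_univ _, hσ⟩, fun a ha => ?_⟩
    simpa [rowS, hitS] using ha
  rw [Finset.card_eq_sum_card_fiberwise hmaps]
  push_cast
  have hfib : ∀ g ∈ t, (((Finset.univ.filter (fun σ : Equiv.Perm (Fin n) =>
      (hitS U σ).card = b)).filter (fun σ => f σ = g)).card : ℝ) ≤ (1 + ε) * m.factorial * E := by
    intro g _
    rcases ((Finset.univ.filter (fun σ : Equiv.Perm (Fin n) =>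
      (hitS U σ).card = b)).filter (fun σ => f σ = g)).eq_empty_or_nonempty with h | ⟨σ₀, h⟩
    · rw [h]; simp; positivity
    · simp only [Finset.mem_filter, Finset.mem_univ, true_and] at h
      refine le_trans ?_ (fib σ₀ h.1)
      norm_cast
      apply Finset.card_le_card
      intro σ hσ
      simp only [Finset.mem_filter, Finset.mem_univ, true_and] at hσ ⊢
      have e : f σ = f σ₀ := hσ.2.trans h.2.symm
      simp only [f, Sigma.mk.injEq] at e
      obtain ⟨e1, e2⟩ := e
      refine ⟨e1, fun j hj => ?_⟩
      have : ∀ (B B' : Finset (Fin n)) (hB : B = B') (σ σ' : Fin n → Fin n),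
          (fun (a : Fin n) (_ : a ∈ B) => σ a) ≍ (fun (a : Fin n) (_ : a ∈ B') => σ' a) →
          ∀ j ∈ B', σ j = σ' j := by
        intro B B' hB σ σ' hh j hj
        subst hB
        exact congrFun (congrFun (eq_of_heq hh) j) hj
      exact this _ _ e1 σ σ₀ e2 j hj
  calc _ ≤ ∑ g ∈ t, (1 + ε) * m.factorial * E := Finset.sum_le_sum hfib
    _ = t.card * ((1 + ε) * m.factorial * E) := by simp
    _ ≤ (n.choose b * (i:ℝ)^b) * ((1 + ε) * m.factorial * E) := by gcongr
    _ = _ := by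
      have h1 := Nat.choose_mul_factorial_mul_factorial (n := n) (k := b) (by omega)
      have h2 : n - b = m := by omega
      rw [h2] at h1
      rw [← h1]
      push_cast
      field_simp

/-- union of graphs -/
def ugr {n k : ℕ} (τ : Fin k → Equiv.Perm (Fin n)) : Finset (Fin n × Fin n) :=
  Finset.univ.biUnion (fun t : Fin k => Finset.univ.image (fun i : Fin n => (i, τ t i)))

lemma mem_ugr {n k : ℕ} (τ : Fin k → Equiv.Perm (Fin n)) (p : Fin n × Fin n) :
    p ∈ ugr τ ↔ ∃ t, τ t p.1 = p.2 := by
  simp only [ugr, Finset.mem_biUnion, Finset.mem_univ, true_and, Finset.mem_image]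
  constructor
  · rintro ⟨t, i, rfl⟩; exact ⟨t, rfl⟩
  · rintro ⟨t, h⟩; exact ⟨t, p.1, Prod.ext rfl h⟩

lemma ugr_row {n k : ℕ} (τ : Fin k → Equiv.Perm (Fin n)) (a : Fin n) :
    ((ugr τ).filter (fun p => p.1 = a)).card ≤ k := by
  have : (ugr τ).filter (fun p => p.1 = a) ⊆ Finset.univ.image (fun t => (a, τ t a)) := by
    rintro ⟨x, y⟩ hp
    simp only [Finset.mem_filter, mem_ugr] at hp
    obtain ⟨⟨t, h⟩, rfl⟩ := hp
    simp only [Finset.mem_image, Finset.mem_univ, true_and]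
    exact ⟨t, by rw [h]⟩
  simpa using (Finset.card_le_card this).trans Finset.card_image_le

lemma ugr_col {n k : ℕ} (τ : Fin k → Equiv.Perm (Fin n)) (v : Fin n) :
    ((ugr τ).filter (fun p => p.2 = v)).card ≤ k := by
  have : (ugr τ).filter (fun p => p.2 = v) ⊆ Finset.univ.image (fun t => ((τ t).symm v, v)) := by
    rintro ⟨x, y⟩ hp
    simp only [Finset.mem_filter, mem_ugr] at hp
    obtain ⟨⟨t, h⟩, rfl⟩ := hp
    simp only [Finset.mem_image, Finset.mem_univ, true_and]
    exact ⟨t, by rw [← h]; simp⟩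
  simpa using (Finset.card_le_card this).trans Finset.card_image_le

lemma ugr_succ {n k : ℕ} (τ : Fin (k+1) → Equiv.Perm (Fin n)) :
    (ugr τ).card + (hitS (ugr (fun t : Fin k => τ t.succ)) (τ 0)).card
      = (ugr (fun t : Fin k => τ t.succ)).card + n := by
  set U := ugr (fun t : Fin k => τ t.succ) with hU
  have h1 : ugr τ = U ∪ Finset.univ.image (fun i : Fin n => (i, τ 0 i)) := by
    ext ⟨x, y⟩
    simp only [hU, mem_ugr, Finset.mem_union, Finset.mem_image, Finset.mem_univ, true_and,
      Fin.exists_fin_succ, Prod.mk.injEq, exists_eq_left]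
    tauto
  have h2 : (hitS U (τ 0)).card = (U ∩ Finset.univ.image (fun i : Fin n => (i, τ 0 i))).card := by
    have : U ∩ Finset.univ.image (fun i : Fin n => (i, τ 0 i))
        = (hitS U (τ 0)).image (fun i : Fin n => (i, τ 0 i)) := by
      ext ⟨x, y⟩
      simp only [hitS, Finset.mem_inter, Finset.mem_image, Finset.mem_univ, true_and,
        Finset.mem_filter, Prod.mk.injEq]
      constructor
      · rintro ⟨h, i, rfl, rfl⟩; exact ⟨i, h, rfl, rfl⟩
      · rintro ⟨i, h, rfl, rfl⟩; exact ⟨h, i, rfl, rfl⟩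
    rw [this, Finset.card_image_of_injective]
    intro i j h; exact (Prod.ext_iff.1 h).1
  have h3 : (Finset.univ.image (fun i : Fin n => (i, τ 0 i))).card = n := by
    rw [Finset.card_image_of_injective]
    · simp
    · intro i j h; exact (Prod.ext_iff.1 h).1
  rw [h1, h2, Finset.card_union_add_card_inter, h3]

lemma ugr_card_le {n k : ℕ} (τ : Fin k → Equiv.Perm (Fin n)) : (ugr τ).card ≤ k * n := by
  unfold ugr
  refine Finset.card_biUnion_le.trans ?_
  calc _ ≤ ∑ t : Fin k, n := Finset.sum_le_sum (fun t _ => Finset.card_image_le.trans (by simp))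
    _ = _ := by simp

/-- tuples with total overlap `a` -/
def tup (n k a : ℕ) : Finset (Fin k → Equiv.Perm (Fin n)) :=
  Finset.univ.filter (fun τ => (ugr τ).card + a = k * n)

lemma tup_step (n k a : ℕ) (Y : ℕ → ℝ)
    (hY : ∀ b ≤ a, ∀ τ ∈ tup n k (a - b), ((Finset.univ.filter
      (fun σ : Equiv.Perm (Fin n) => (hitS (ugr τ) σ).card = b)).card : ℝ) ≤ Y b) :
    ((tup n (k+1) a).card : ℝ) ≤ ∑ b ∈ Finset.range (a + 1), ((tup n k (a - b)).card : ℝ) * Y b := by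
  classical
  let tl : (Fin (k+1) → Equiv.Perm (Fin n)) → (Fin k → Equiv.Perm (Fin n)) := fun τ t => τ t.succ
  let h : (Fin (k+1) → Equiv.Perm (Fin n)) → ℕ := fun τ => (hitS (ugr (tl τ)) (τ 0)).card
  have key : ∀ τ ∈ tup n (k+1) a, h τ ≤ a ∧ tl τ ∈ tup n k (a - h τ) := by
    intro τ hτ
    have h1 := ugr_succ τ
    have h2 := ugr_card_le (tl τ)
    simp only [tup, Finset.mem_filter, Finset.mem_univ, true_and] at hτ ⊢
    change _ + h τ = (ugr (tl τ)).card + n at h1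
    rw [add_mul, one_mul] at hτ
    omega
  rw [Finset.card_eq_sum_card_fiberwise (f := h) (t := Finset.range (a+1))
    (fun τ hτ => by have := (key τ hτ).1; simp; omega)]
  push_cast
  apply Finset.sum_le_sum
  intro b hb
  have hb' : b ≤ a := by simp at hb; omega
  rw [Finset.card_eq_sum_card_fiberwise (f := tl) (t := tup n k (a - b)) (by
    intro τ hτ
    simp only [Finset.coe_filter, Set.mem_ofPred_eq] at hτ
    have := (key τ hτ.1).2
    rw [hτ.2] at this
    exact this)]
  push_cast
  calc _ ≤ ∑ τ ∈ tup n k (a - b), Y b := by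
        apply Finset.sum_le_sum
        intro τ hτ
        refine le_trans ?_ (hY b hb' τ hτ)
        norm_cast
        apply Finset.card_le_card_of_injOn (fun τ' => τ' 0)
        · intro τ' hτ'
          simp only [Finset.coe_filter, Finset.mem_filter, Set.mem_ofPred_eq, Finset.mem_univ, true_and] at hτ' ⊢
          rw [← hτ'.2]; exact hτ'.1.2
        · intro x hx y hy hxy
          simp only [Finset.coe_filter, Finset.mem_filter, Set.mem_ofPred_eq] at hx hy
          funext t
          refine Fin.cases hxy (fun t => ?_) t
          exact congrFun (hx.2.trans hy.2.symm) t
    _ = _ := by simp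

lemma binom_sum (x y : ℝ) (a : ℕ) :
    ∑ b ∈ Finset.range (a+1), x ^ (a - b) / (a - b).factorial * (y ^ b / b.factorial)
      = (x + y) ^ a / a.factorial := by
  rw [add_comm x y, add_pow, Finset.sum_div]
  apply Finset.sum_congr rfl
  intro b hb
  have hb' : b ≤ a := by simp at hb; omega
  have h1 := Nat.choose_mul_factorial_mul_factorial hb'
  have h2 : ((a.choose b : ℝ)) * b.factorial * (a - b).factorial = a.factorial := by exact_mod_cast h1
  have : (a.choose b : ℝ) = a.factorial / (b.factorial * (a-b).factorial) := by
    field_simp; linarith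
  rw [this]
  field_simp

lemma tup_le (ε : ℝ) (hε : 0 < ε) : ∃ m0 : ℕ, ∀ n, 0 < n → ∀ k a : ℕ, m0 + a ≤ n →
    ((tup n k a).card : ℝ) ≤ (1 + ε) ^ k * Real.exp (-((k : ℝ) * ((k : ℝ) - 1) / 2))
            * (Nat.factorial n : ℝ) ^ k * (((k : ℝ) * ((k : ℝ) - 1) / 2) ^ a
            / (Nat.factorial a : ℝ)) * Real.exp (3 * k * a / n) := by
  obtain ⟨m0, hm0⟩ := hits_le ε hε
  refine ⟨m0, fun n hn k => ?_⟩
  have hn' : (0:ℝ) < n := by exact_mod_cast hn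
  induction k with
  | zero =>
    intro a _
    rcases Nat.eq_zero_or_pos a with rfl | ha
    · simp only [tup]
      refine le_trans (Nat.cast_le.2 (Finset.card_filter_le _ _)) ?_
      simp
    · have : tup n 0 a = ∅ := by
        unfold tup
        rw [Finset.filter_eq_empty_iff]
        intro τ _ h
        omega
      rw [this]
      simp only [Finset.card_empty]
      push_cast
      simp [ha.ne']
  | succ k ih =>
    intro a ha
    have hq : (0:ℝ) ≤ (k : ℝ) * ((k : ℝ) - 1) / 2 := by
      rcases Nat.eq_zero_or_pos k with rfl | hk
      · simp
      · have : (1:ℝ) ≤ k := by exact_mod_cast hk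
        have : (0:ℝ) ≤ (k:ℝ) - 1 := by linarith
        positivity
    have hstep := tup_step n k a (fun b => (1 + ε) * n.factorial * (k:ℝ) ^ b / b.factorial
        * Real.exp (-((((k:ℝ) * n - (a - b)) - 2 * b * k) / n))) (by
      intro b hb τ hτ
      have h1 := hm0 n b k (by omega) (ugr τ) (ugr_row τ) (ugr_col τ)
      have h2 : ((ugr τ).card : ℝ) = (k:ℝ) * n - (a - b) := by
        simp only [tup, Finset.mem_filter, Finset.mem_univ, true_and] at hτ
        have : ((ugr τ).card : ℝ) + ((a - b : ℕ) : ℝ) = k * n := by exact_mod_cast hτ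
        rw [Nat.cast_sub hb] at this
        linarith
      rw [h2] at h1
      exact h1)
    refine hstep.trans ?_
    set q : ℝ := (k : ℝ) * ((k : ℝ) - 1) / 2 with hqdef
    have hq1 : ((k + 1 : ℕ) : ℝ) * (((k + 1 : ℕ) : ℝ) - 1) / 2 = q + k := by
      rw [hqdef]; push_cast; ring
    rw [hq1]
    calc _ ≤ ∑ b ∈ Finset.range (a+1), ((1 + ε) ^ (k+1) * Real.exp (-(q + k)) * (n.factorial : ℝ) ^ (k+1)
          * Real.exp (3 * (k+1 : ℕ) * a / n)) * (q ^ (a - b) / (a - b).factorial * ((k:ℝ) ^ b / b.factorial)) := by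
          apply Finset.sum_le_sum
          intro b hb
          have hb' : b ≤ a := by simp at hb; omega
          have hba : (b:ℝ) ≤ a := by exact_mod_cast hb'
          have h1 := ih (a - b) (by omega)
          rw [Nat.cast_sub hb'] at h1
          have hexp : Real.exp (-q) * Real.exp (3 * k * ((a:ℝ) - b) / n) *
              Real.exp (-((((k:ℝ) * n - (a - b)) - 2 * b * k) / n))
              ≤ Real.exp (-(q + k)) * Real.exp (3 * (k+1 : ℕ) * a / n) := by
            rw [← Real.exp_add, ← Real.exp_add, ← Real.exp_add]
            apply Real.exp_le_exp.2
            have e1 : (((k:ℝ) * n - (a - b)) - 2 * b * k) / n = k - ((a - b) + 2 * b * k) / n := by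
              field_simp; ring
            rw [e1]
            have e2 : 3 * k * ((a:ℝ) - b) / n + ((a - b) + 2 * b * k) / n ≤ 3 * (k+1 : ℕ) * a / n := by
              rw [← add_div]
              gcongr
              push_cast
              have : (0:ℝ) ≤ (b:ℝ) * k := by positivity
              have : (0:ℝ) ≤ (b:ℝ) := by positivity
              nlinarith
            linarith
          calc _ ≤ ((1 + ε) ^ k * Real.exp (-q) * (n.factorial : ℝ) ^ k * (q ^ (a - b)
            / ((a - b).factorial : ℝ)) * Real.exp (3 * k * ((a:ℝ) - b) / n)) * ((1 + ε) * n.factorial * (k:ℝ) ^ b / b.factorial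
                * Real.exp (-((((k:ℝ) * n - (a - b)) - 2 * b * k) / n))) := by gcongr
            _ = ((1 + ε) ^ (k+1) * (n.factorial : ℝ) ^ (k+1) * (q ^ (a - b) / (a - b).factorial * ((k:ℝ) ^ b / b.factorial)))
              * (Real.exp (-q) * Real.exp (3 * k * ((a:ℝ) - b) / n) *
              Real.exp (-((((k:ℝ) * n - (a - b)) - 2 * b * k) / n))) := by ring
            _ ≤ ((1 + ε) ^ (k+1) * (n.factorial : ℝ) ^ (k+1) * (q ^ (a - b) / (a - b).factorial * ((k:ℝ) ^ b / b.factorial)))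
              * (Real.exp (-(q + k)) * Real.exp (3 * (k+1 : ℕ) * a / n)) := by gcongr
            _ = _ := by ring
      _ = _ := by
          rw [← Finset.mul_sum, binom_sum]
          ring

lemma main_part (ε : ℝ) (hε : 0 < ε) : ∃ N : ℕ, 0 < N ∧ ∀ n : ℕ, N ≤ n → ∀ k a : ℕ, 2 ≤ k →
      ((k : ℝ) * (a : ℝ) ≤ (n : ℝ) / (N : ℝ)) →
      (Mcount n k a : ℝ)
        ≤ (1 + ε) ^ k * Real.exp (-((k : ℝ) * ((k : ℝ) - 1) / 2))
            * (Nat.factorial n : ℝ) ^ k * ((k : ℝ) * ((k : ℝ) - 1) / 2) ^ a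
            / (Nat.factorial a : ℝ) := by
  have hs : 1 < √(1 + ε) := by rw [Real.lt_sqrt] <;> linarith
  have hs2 : √(1 + ε) * √(1 + ε) = 1 + ε := Real.mul_self_sqrt (by linarith)
  set s := √(1 + ε)
  obtain ⟨m0, hm0⟩ := tup_le (s - 1) (by linarith)
  have hlog : 0 < Real.log s := Real.log_pos hs
  obtain ⟨N1, hN1⟩ := exists_nat_gt (3 / Real.log s)
  refine ⟨max N1 (2 * m0 + 1), by omega, fun n hn k a hk hka => ?_⟩
  set N := max N1 (2 * m0 + 1) with hN
  have hNpos : (0:ℝ) < N := by exact_mod_cast (by omega : 0 < N)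
  have hn0 : 0 < n := by omega
  have hn0' : (0:ℝ) < n := by exact_mod_cast hn0
  have hk2 : (2:ℝ) ≤ k := by exact_mod_cast hk
  have hN1le : (1:ℝ) ≤ N := by exact_mod_cast (by omega : 1 ≤ N)
  have h2a : 2 * a ≤ n := by
    have : (2:ℝ) * a ≤ n := by
      calc (2:ℝ) * a ≤ k * a := by gcongr
        _ ≤ n / N := hka
        _ ≤ n := div_le_self hn0'.le hN1le
    exact_mod_cast this
  have h := hm0 n hn0 k a (by omega)
  have hM : Mcount n k a = (tup n k a).card := by
    unfold Mcount tup
    congr 1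
    ext τ
    simp only [Finset.mem_filter, Finset.mem_univ, true_and]
    change (ugr τ).card = k * n - a ↔ _
    have : 2 * n ≤ k * n := Nat.mul_le_mul_right n hk
    omega
  rw [hM]
  refine h.trans ?_
  have hexp : Real.exp (3 * k * a / n) ≤ s ^ k := by
    have e1 : 3 * (k:ℝ) * a / n ≤ Real.log s := by
      calc 3 * (k:ℝ) * a / n = 3 * (k * a) / n := by ring
        _ ≤ 3 * (n / N) / n := by gcongr
        _ = 3 / N := by field_simp
        _ ≤ Real.log s := by
          rw [div_le_iff₀ hNpos]
          rw [div_lt_iff₀ hlog] at hN1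
          have : (N1:ℝ) ≤ N := by exact_mod_cast (by omega : N1 ≤ N)
          nlinarith
    calc Real.exp (3 * k * a / n) ≤ Real.exp (Real.log s) := Real.exp_le_exp.2 e1
      _ = s := Real.exp_log (by linarith)
      _ ≤ s ^ k := le_self_pow₀ hs.le (by omega)
  have hq : (0:ℝ) ≤ (k : ℝ) * ((k : ℝ) - 1) / 2 := by
    have : (0:ℝ) ≤ (k:ℝ) - 1 := by linarith
    positivity
  have hs1 : 1 + (s - 1) = s := by ring
  rw [hs1]
  have hs0 : 0 < s := by linarith
  calc _ ≤ s ^ k * Real.exp (-((k : ℝ) * ((k : ℝ) - 1) / 2))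
            * (Nat.factorial n : ℝ) ^ k * (((k : ℝ) * ((k : ℝ) - 1) / 2) ^ a
            / (Nat.factorial a : ℝ)) * s ^ k := by gcongr
    _ = _ := by rw [← hs2, mul_pow]; ring

/-- For every `ε > 0` there is `N` such that for all `n ≥ N`, `k ≥ 2` and `a` with
`k·a ≤ n/N`, `M(a) ≤ (1+ε)^k exp(-k(k-1)/2) (n!)^k (k(k-1)/2)^a / a!`. In particular,
for sequences with `k_n ≥ 2` and `k_n a_n = o(n)`, eventually
`M(a_n) ≤ 2^{k_n} exp(-k_n(k_n-1)/2) (n!)^{k_n} (k_n(k_n-1)/2)^{a_n} / a_n!`. -/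
theorem Mcount_refined_le :
    (∀ ε : ℝ, 0 < ε → ∃ N : ℕ, 0 < N ∧ ∀ n : ℕ, N ≤ n → ∀ k a : ℕ, 2 ≤ k →
      ((k : ℝ) * (a : ℝ) ≤ (n : ℝ) / (N : ℝ)) →
      (Mcount n k a : ℝ)
        ≤ (1 + ε) ^ k * Real.exp (-((k : ℝ) * ((k : ℝ) - 1) / 2))
            * (Nat.factorial n : ℝ) ^ k * ((k : ℝ) * ((k : ℝ) - 1) / 2) ^ a
            / (Nat.factorial a : ℝ))
    ∧ (∀ k a : ℕ → ℕ, (∀ n, 2 ≤ k n) →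
        (fun n : ℕ => (k n : ℝ) * (a n : ℝ)) =o[atTop] (fun n : ℕ => (n : ℝ)) →
        ∀ᶠ n in atTop,
          (Mcount n (k n) (a n) : ℝ)
            ≤ 2 ^ (k n) * Real.exp (-((k n : ℝ) * ((k n : ℝ) - 1) / 2))
                * (Nat.factorial n : ℝ) ^ (k n)
                * ((k n : ℝ) * ((k n : ℝ) - 1) / 2) ^ (a n)
                / (Nat.factorial (a n) : ℝ)) := by
  refine ⟨main_part, fun k a hk ho => ?_⟩
  obtain ⟨N, hN, h⟩ := main_part 1 one_pos
  have hNpos : (0:ℝ) < N := by exact_mod_cast hN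
  filter_upwards [ho.bound (inv_pos.2 hNpos), eventually_ge_atTop N] with n h1 h2
  have h3 := h n h2 (k n) (a n) (hk n) (by
    rw [Real.norm_of_nonneg (by positivity), Real.norm_of_nonneg (by positivity)] at h1
    rw [div_eq_inv_mul]; exact h1)
  rw [one_add_one_eq_two] at h3
  exact h3
end
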